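/- The right-handed trefoil knot is not ambient isotopic to the left-handed trefoil knot; that is, the trefoil is not amphicheiral. -/

import Mathlib

/-- Two subsets of `ℝ³` are ambient isotopic if there is a continuous family of
homeomorphisms of `ℝ³`, starting at the identity, carrying the first set onto the second. -/
def AmbientIsotopic (A B : Set (Fin 3 → ℝ)) : Prop :=
  ∃ F : ℝ → (Fin 3 → ℝ) → (Fin 3 → ℝ),
    Continuous (fun p : ℝ × (Fin 3 → ℝ) => F p.1 p.2) ∧
    (∀ t : ℝ, IsHomeomorph (F t)) ∧
    F 0 = id ∧ F 1 '' A = B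

/-- A parametrization of the right-handed trefoil knot in `ℝ³`. -/
noncomputable def trefoil (t : ℝ) : Fin 3 → ℝ :=
  ![Real.sin t + 2 * Real.sin (2 * t), Real.cos t - 2 * Real.cos (2 * t), -Real.sin (3 * t)]

/-- The mirror reflection of `ℝ³` in the plane of the first two coordinates. -/
def mirror (p : Fin 3 → ℝ) : Fin 3 → ℝ := ![p 0, p 1, -(p 2)]

open Complex ComplexConjugate Filter Topology

/-- A nonvanishing complex function on the plane has a continuous logarithm. -/
theorem exists_continuous_log (f : ℝ × ℝ → ℂ) (hf : Continuous f) (h0 : ∀ x, f x ≠ 0) :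
    ∃ L : ℝ × ℝ → ℂ, Continuous L ∧ ∀ x, exp (L x) = f x := by
  obtain ⟨F, ⟨-, hF⟩, -⟩ := isCoveringMapOn_exp.existsUnique_continuousMap_lifts
    (⟨f, hf⟩ : C(ℝ × ℝ, ℂ)) (a₀ := (0, 0)) (e₀ := log (f (0, 0))) (exp_log (h0 _)) (by simpa using h0)
  exact ⟨F, F.continuous, fun x => congrFun hF x⟩

/-- A continuous logarithm of the constant function `1` is constant. -/
theorem exists_int_of_exp_eq_one {X : Type*} [TopologicalSpace X] [PreconnectedSpace X]
    (g : X → ℂ) (hg : Continuous g) (h : ∀ x, exp (g x) = 1) :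
    ∃ n : ℤ, ∀ x, g x = n * (2 * Real.pi * I) := by
  have hpi : (2 * Real.pi * I : ℂ) ≠ 0 := by simp [Real.pi_ne_zero]
  choose m hm using fun x => exp_eq_one_iff.1 (h x)
  have hc : Continuous m := by
    have h1 : Continuous fun x => (m x : ℝ) := by
      have : (fun x => (m x : ℝ)) = fun x => (g x / (2 * Real.pi * I)).re := by
        funext x
        rw [hm x, mul_div_assoc, div_self hpi]; simp
      rw [this]; fun_prop
    exact Int.isClosedEmbedding_coe_real.isEmbedding.continuous_iff.2 h1
  rcases isEmpty_or_nonempty X with hX | ⟨⟨x0⟩⟩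
  · exact ⟨0, fun x => (hX.false x).elim⟩
  · refine ⟨m x0, fun x => ?_⟩
    rw [hm x, PreconnectedSpace.constant ‹_› hc (x := x) (y := x0)]

theorem exists_int_period_log (f L : ℝ × ℝ → ℂ) (hL : Continuous L) (hfL : ∀ x, exp (L x) = f x)
    (T : ℝ) (hT : ∀ s τ, f (s + T, τ) = f (s, τ)) :
    ∃ n : ℤ, ∀ s τ, L (s + T, τ) = L (s, τ) + n * (2 * Real.pi * I) := by
  obtain ⟨n, hn⟩ := exists_int_of_exp_eq_one (fun x : ℝ × ℝ => L (x.1 + T, x.2) - L x)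
    (by fun_prop) (fun x => by
      rw [exp_sub, hfL, hfL, hT]
      exact div_self (by rw [← hfL]; exact exp_ne_zero _))
  exact ⟨n, fun s τ => by rw [← hn (s, τ)]; ring⟩

theorem exists_sign_lift (a b d : ℝ × ℝ → ℂ) (ha : Continuous a) (hb : Continuous b)
    (hd : Continuous d) (h : ∀ x, a x * d x = b x ^ 2) (h0 : ∀ x, a x = 0 → d x ≠ 0) :
    ∃ u v : ℝ × ℝ → ℂ, Continuous u ∧ Continuous v ∧
      ∀ x, u x ^ 2 = a x ∧ u x * v x = b x ∧ v x ^ 2 = d x := by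
  let X := {m : ℂ × ℂ × ℂ // m.1 * m.2.2 = m.2.1 ^ 2}
  let φ : ℂ × ℂ → X := fun v => ⟨(v.1 ^ 2, v.1 * v.2, v.2 ^ 2), by ring⟩
  have hφc : Continuous φ := by
    apply Continuous.subtype_mk; fun_prop
  have hsurj : ∀ m : ℂ × ℂ × ℂ, m.1 * m.2.2 = m.2.1 ^ 2 →
      ∃ v : ℂ × ℂ, v.1 ^ 2 = m.1 ∧ v.1 * v.2 = m.2.1 ∧ v.2 ^ 2 = m.2.2 := by
    rintro ⟨m1, m2, m3⟩ hm
    dsimp only at hm ⊢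
    obtain ⟨s, hs⟩ := IsSquare.exists_sq m1 (IsAlgClosed.exists_pow_nat_eq m1 two_pos |>.imp
      fun z hz => by rw [← hz, sq])
    by_cases hm1 : m1 = 0
    · obtain ⟨z, hz⟩ := IsAlgClosed.exists_pow_nat_eq m3 two_pos
      refine ⟨(0, z), by simp [hm1], ?_, hz⟩
      have : m2 ^ 2 = 0 := by rw [← hm, hm1, zero_mul]
      simpa using (pow_eq_zero_iff two_ne_zero |>.1 this).symm
    · have hs0 : s ≠ 0 := by rintro rfl; exact hm1 (by rw [hs]; ring)
      refine ⟨(s, m2 / s), hs.symm, by field_simp, ?_⟩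
      rw [div_pow, ← hs, ← hm]
      exact mul_div_cancel_left₀ _ hm1
  have hproper : IsProperMap φ := by
    rw [isProperMap_iff_tendsto_cocompact]
    refine ⟨hφc, ?_⟩
    have h1 : Filter.Tendsto (fun v => ((φ v).1 : ℂ × ℂ × ℂ)) (Filter.cocompact _)
        (Filter.cocompact _) := by
      rw [← Metric.cobounded_eq_cocompact, ← Metric.cobounded_eq_cocompact,
        ← tendsto_norm_atTop_iff_cobounded, Filter.tendsto_atTop]
      intro r
      have h2 : Filter.Tendsto (fun v : ℂ × ℂ => ‖v‖) (Bornology.cobounded _) Filter.atTop :=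
        tendsto_norm_cobounded_atTop
      filter_upwards [h2.eventually_ge_atTop (|r| + 1)] with v hv
      have h3 : ‖v‖ ^ 2 ≤ ‖((φ v).1 : ℂ × ℂ × ℂ)‖ := by
        rcases max_choice ‖v.1‖ ‖v.2‖ with h | h
        · rw [Prod.norm_def, h]
          simp [φ]
        · rw [Prod.norm_def, h]
          simp [φ]
      nlinarith [le_abs_self r, abs_nonneg r]
    exact h1.of_tendsto_comp (Filter.comap_cocompact_le continuous_subtype_val)
  have hq : Topology.IsQuotientMap φ := hproper.isClosedMap.isQuotientMap hφc (by
    rintro ⟨m, hm⟩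
    obtain ⟨v, h1, h2, h3⟩ := hsurj m hm
    exact ⟨v, Subtype.ext (Prod.ext h1 (Prod.ext h2 h3))⟩)
  have hcov := hq.isCoveringMapOn_of_properlyDiscontinuousSMul (G := ℤˣ) (by
    intro v w
    constructor
    · intro hvw
      have h1 : v.1 ^ 2 = w.1 ^ 2 := congrArg (fun m : X => m.1.1) hvw
      have h2 : v.1 * v.2 = w.1 * w.2 := congrArg (fun m : X => m.1.2.1) hvw
      have h3 : v.2 ^ 2 = w.2 ^ 2 := congrArg (fun m : X => m.1.2.2) hvw
      rcases sq_eq_sq_iff_eq_or_eq_neg.1 h1 with e1 | e1 <;>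
      rcases sq_eq_sq_iff_eq_or_eq_neg.1 h3 with e3 | e3
      · exact ⟨1, by simp [Prod.ext_iff, e1, e3]⟩
      · rw [e1, e3] at h2
        have : w.1 * w.2 = 0 := by linear_combination (-1 / 2) * h2
        rcases mul_eq_zero.1 this with e | e
        · exact ⟨-1, by simp [Prod.ext_iff, e1, e3, e]⟩
        · exact ⟨1, by simp [Prod.ext_iff, e1, e3, e]⟩
      · rw [e1, e3] at h2
        have : w.1 * w.2 = 0 := by linear_combination (-1 / 2) * h2
        rcases mul_eq_zero.1 this with e | e
        · exact ⟨1, by simp [Prod.ext_iff, e1, e3, e]⟩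
        · exact ⟨-1, by simp [Prod.ext_iff, e1, e3, e]⟩
      · exact ⟨-1, by simp [Prod.ext_iff, e1, e3]⟩
    · rintro ⟨g, rfl⟩
      rcases Int.units_eq_one_or g with rfl | rfl <;> simp [φ])
  let F : C(ℝ × ℝ, X) := ⟨fun x => ⟨(a x, b x, d x), h x⟩, by
    apply Continuous.subtype_mk; fun_prop⟩
  have hF : ∀ x, F x ∈ φ '' {e | MulAction.stabilizer ℤˣ e = ⊥} := by
    intro x
    obtain ⟨v, h1, h2, h3⟩ := hsurj (a x, b x, d x) (h x)
    refine ⟨v, ?_, Subtype.ext (Prod.ext h1 (Prod.ext h2 h3))⟩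
    rw [Set.mem_ofPred_eq, eq_bot_iff]
    intro g hg
    rcases Int.units_eq_one_or g with rfl | rfl
    · simp
    · exfalso
      have hg' : -v = v := by simpa [MulAction.mem_stabilizer_iff] using hg
      have : v = 0 := self_eq_neg.1 hg'.symm
      subst this
      exact h0 x (by simpa using h1.symm) (by simpa using h3.symm)
  obtain ⟨v0, -, hv0⟩ := hF (0, 0)
  obtain ⟨G, ⟨-, hG⟩, -⟩ := hcov.existsUnique_continuousMap_lifts F hv0 hF
  refine ⟨fun x => (G x).1, fun x => (G x).2, by fun_prop, by fun_prop, fun x => ?_⟩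
  have := congrArg Subtype.val (congrFun hG x)
  simp only [Prod.ext_iff] at this
  exact ⟨this.1, this.2.1, this.2.2⟩

theorem sign_lift_unique {X : Type*} [TopologicalSpace X] [PreconnectedSpace X]
    (u v u' v' : X → ℂ) (hu : Continuous u) (hv : Continuous v) (hu' : Continuous u')
    (hv' : Continuous v') (h0 : ∀ x, u x = 0 → v x ≠ 0) (h1 : ∀ x, u x ^ 2 = u' x ^ 2)
    (h2 : ∀ x, u x * v x = u' x * v' x) (h3 : ∀ x, v x ^ 2 = v' x ^ 2) :
    (∀ x, u' x = u x ∧ v' x = v x) ∨ (∀ x, u' x = -u x ∧ v' x = -v x) := by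
  have hcases : ∀ x, (u' x = u x ∧ v' x = v x) ∨ (u' x = -u x ∧ v' x = -v x) := by
    intro x
    have h2 := h2 x
    rcases sq_eq_sq_iff_eq_or_eq_neg.1 (h1 x) with e1 | e1 <;>
    rcases sq_eq_sq_iff_eq_or_eq_neg.1 (h3 x) with e3 | e3
    · simp [e1, e3]
    · rw [e1, e3] at h2
      have : u' x * v' x = 0 := by linear_combination (-1 / 2) * h2
      rcases mul_eq_zero.1 this with e | e <;> simp [e, e1, e3]
    · rw [e1, e3] at h2
      have : u' x * v' x = 0 := by linear_combination (-1 / 2) * h2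
      rcases mul_eq_zero.1 this with e | e <;> simp [e, e1, e3]
    · simp [e1, e3]
  let s := {x | u' x = u x ∧ v' x = v x}
  let t := {x | u' x = -u x ∧ v' x = -v x}
  have hs : IsClosed s := (isClosed_eq hu' hu).inter (isClosed_eq hv' hv)
  have ht : IsClosed t := (isClosed_eq hu' hu.neg).inter (isClosed_eq hv' hv.neg)
  have hst : s = tᶜ := by
    ext x
    refine ⟨fun hx hx' => ?_, fun hx => (hcases x).resolve_right hx⟩
    have e1 : u x = 0 := self_eq_neg.1 (hx.1.symm.trans hx'.1)
    have e2 : v x = 0 := self_eq_neg.1 (hx.2.symm.trans hx'.2)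
    exact h0 x e1 e2
  have hclopen : IsClopen s := ⟨hs, by rw [hst]; exact ht.isOpen_compl⟩
  rcases isClopen_iff.1 hclopen with h | h
  · right
    intro x
    exact (hcases x).resolve_left fun hx => by
      have : x ∈ s := hx
      rw [h] at this; exact this
  · left
    intro x
    have : x ∈ s := by rw [h]; trivial
    exact this

/-- A lift of a pair of functions `(A, B)` with `A ^ 3 ≠ B ^ 2` to the curve
`v ^ 2 = u ^ 4 + 3 * u ^ 2 + 3`, up to the scaling `c`, which satisfies `c ^ 6 = A ^ 3 - B ^ 2`. -/
structure CuspLift {X : Type*} [TopologicalSpace X] (A B c u v : X → ℂ) : Prop where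
  continuous_c : Continuous c
  continuous_u : Continuous u
  continuous_v : Continuous v
  c_ne : ∀ x, c x ≠ 0
  eq_A : ∀ x, A x = c x ^ 2 * (1 + u x ^ 2)
  eq_B : ∀ x, B x = c x ^ 3 * (u x * v x)
  eq_v : ∀ x, v x ^ 2 = u x ^ 4 + 3 * u x ^ 2 + 3

theorem exists_root_of_unity_ratio {X : Type*} [TopologicalSpace X] [PreconnectedSpace X]
    [Nonempty X] (c c' : X → ℂ) (hc : Continuous c) (hc' : Continuous c') (h0 : ∀ x, c x ≠ 0)
    (h : ∀ x, c' x ^ 6 = c x ^ 6) : ∃ κ : ℂ, κ ^ 6 = 1 ∧ ∀ x, c' x = κ * c x := by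
  have hfin : Set.Finite {z : ℂ | z ^ 6 = 1} := by
    refine (Polynomial.nthRootsFinset 6 (1 : ℂ)).finite_toSet.subset fun z hz => ?_
    simpa [Polynomial.mem_nthRootsFinset] using hz
  have hmaps : ∀ x, c' x / c x ∈ {z : ℂ | z ^ 6 = 1} := fun x => by
    change (c' x / c x) ^ 6 = 1
    rw [div_pow, h, div_self (pow_ne_zero _ (h0 x))]
  obtain ⟨x0⟩ := ‹Nonempty X›
  refine ⟨c' x0 / c x0, hmaps x0, fun x => ?_⟩
  have hd : DiscreteTopology {z : ℂ | z ^ 6 = 1} := hfin.isDiscrete.to_subtype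
  have := isPreconnected_univ.constant_of_mapsTo hfin.isDiscrete
    (f := fun x => c' x / c x) (hc'.div hc h0).continuousOn (fun x _ => hmaps x)
    (Set.mem_univ x0) (Set.mem_univ x)
  rw [this, div_mul_cancel₀ _ (h0 x)]

namespace CuspLift

variable {X : Type*} [TopologicalSpace X] {A B c u v c' u' v' : X → ℂ}

theorem pow_six (h : CuspLift A B c u v) (x : X) : c x ^ 6 = A x ^ 3 - B x ^ 2 := by
  rw [h.eq_A, h.eq_B]
  linear_combination c x ^ 6 * u x ^ 2 * h.eq_v x

theorem comp {Y : Type*} [TopologicalSpace Y] (h : CuspLift A B c u v) (g : Y → X)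
    (hg : Continuous g) : CuspLift (A ∘ g) (B ∘ g) (c ∘ g) (u ∘ g) (v ∘ g) where
  continuous_c := h.continuous_c.comp hg
  continuous_u := h.continuous_u.comp hg
  continuous_v := h.continuous_v.comp hg
  c_ne x := h.c_ne (g x)
  eq_A x := h.eq_A (g x)
  eq_B x := h.eq_B (g x)
  eq_v x := h.eq_v (g x)

theorem neg (h : CuspLift A B c u v) : CuspLift A B c (-u) (-v) where
  continuous_c := h.continuous_c
  continuous_u := h.continuous_u.neg
  continuous_v := h.continuous_v.neg
  c_ne := h.c_ne
  eq_A x := by simpa using h.eq_A x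
  eq_B x := by simpa using h.eq_B x
  eq_v x := by
    have := h.eq_v x
    simp only [Pi.neg_apply]
    linear_combination this

theorem u_ne_or (h : CuspLift A B c u v) (x : X) (hu : u x = 0) : v x ≠ 0 := by
  intro hv
  have := h.eq_v x
  rw [hu, hv] at this
  norm_num at this

/-- Two lifts with the same scaling differ by a global sign. -/
theorem eq_or_eq_neg [PreconnectedSpace X] (h : CuspLift A B c u v)
    (h' : CuspLift A B c u' v') : (u' = u ∧ v' = v) ∨ (u' = -u ∧ v' = -v) := by
  have h1 : ∀ x, u x ^ 2 = u' x ^ 2 := fun x => by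
    have := (h.eq_A x).symm.trans (h'.eq_A x)
    have := mul_left_cancel₀ (pow_ne_zero 2 (h.c_ne x)) this
    linear_combination this
  have := sign_lift_unique u v u' v' h.continuous_u h.continuous_v h'.continuous_u h'.continuous_v
    h.u_ne_or h1 (fun x => mul_left_cancel₀ (pow_ne_zero 3 (h.c_ne x))
      ((h.eq_B x).symm.trans (h'.eq_B x)))
    (fun x => by
      rw [h.eq_v, h'.eq_v]
      linear_combination (u x ^ 2 + u' x ^ 2 + 3) * h1 x)
  rcases this with this | this
  · exact Or.inl ⟨funext fun x => (this x).1, funext fun x => (this x).2⟩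
  · exact Or.inr ⟨funext fun x => (this x).1, funext fun x => (this x).2⟩

theorem unique [PreconnectedSpace X] (h : CuspLift A B c u v) (h' : CuspLift A B c' u' v')
    (x0 : X) (hc0 : c' x0 = c x0) (hu0 : u' x0 = u x0) (hv0 : v' x0 = v x0) :
    c' = c ∧ u' = u ∧ v' = v := by
  have : Nonempty X := ⟨x0⟩
  obtain ⟨κ, -, hκ⟩ := exists_root_of_unity_ratio c c' h.continuous_c h'.continuous_c h.c_ne
    (fun x => by rw [h.pow_six, h'.pow_six])
  have hκ1 : κ = 1 := by
    have := hκ x0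
    rw [hc0] at this
    exact (mul_right_cancel₀ (h.c_ne x0) (by rw [one_mul]; exact this)).symm
  have hcc : c' = c := funext fun x => by rw [hκ, hκ1, one_mul]
  subst hcc
  refine ⟨rfl, ?_⟩
  rcases h.eq_or_eq_neg h' with e | ⟨e1, e2⟩
  · exact e
  · exfalso
    rw [e1, Pi.neg_apply] at hu0
    rw [e2, Pi.neg_apply] at hv0
    exact h.u_ne_or x0 (self_eq_neg.1 hu0.symm) (self_eq_neg.1 hv0.symm)

end CuspLift

theorem exists_cuspLift_point (A B : ℂ) (h : A ^ 3 ≠ B ^ 2) :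
    ∃ c u v : ℂ, c ≠ 0 ∧ A = c ^ 2 * (1 + u ^ 2) ∧ B = c ^ 3 * (u * v) ∧
      v ^ 2 = u ^ 4 + 3 * u ^ 2 + 3 := by
  obtain ⟨c, hc⟩ := IsAlgClosed.exists_pow_nat_eq (A ^ 3 - B ^ 2) (n := 6) (by norm_num)
  have hc0 : c ≠ 0 := by
    rintro rfl
    exact h (sub_eq_zero.1 (by rw [← hc]; norm_num))
  obtain ⟨u, hu⟩ := IsAlgClosed.exists_pow_nat_eq (A / c ^ 2 - 1) two_pos
  have hA : A = c ^ 2 * (1 + u ^ 2) := by rw [hu]; field_simp; ring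
  have hB : B ^ 2 = c ^ 6 * (u ^ 2 * (u ^ 4 + 3 * u ^ 2 + 3)) := by
    have : B ^ 2 = A ^ 3 - c ^ 6 := by rw [hc]; ring
    rw [this, hA]; ring
  by_cases hu0 : u = 0
  · obtain ⟨v, hv⟩ := IsAlgClosed.exists_pow_nat_eq (3 : ℂ) two_pos
    refine ⟨c, u, v, hc0, hA, ?_, by rw [hv, hu0]; ring⟩
    rw [hu0] at hB ⊢
    have : B = 0 := by simpa using hB
    rw [this]; ring
  · refine ⟨c, u, B / (c ^ 3 * u), hc0, hA, by field_simp, ?_⟩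
    rw [div_pow, hB]; field_simp

theorem exists_cuspLift (A B : ℝ × ℝ → ℂ) (hA : Continuous A) (hB : Continuous B)
    (h : ∀ x, A x ^ 3 ≠ B x ^ 2) (c0 u0 v0 : ℂ) (hc0 : c0 ≠ 0)
    (hA0 : A (0, 0) = c0 ^ 2 * (1 + u0 ^ 2)) (hB0 : B (0, 0) = c0 ^ 3 * (u0 * v0))
    (hv0 : v0 ^ 2 = u0 ^ 4 + 3 * u0 ^ 2 + 3) :
    ∃ c u v : ℝ × ℝ → ℂ, CuspLift A B c u v ∧ c (0, 0) = c0 ∧ u (0, 0) = u0 ∧ v (0, 0) = v0 := by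
  obtain ⟨L, hL, hexp⟩ := exists_continuous_log (fun x => A x ^ 3 - B x ^ 2) (by fun_prop)
    (fun x => sub_ne_zero.2 (h x))
  let k := c0 / exp (L (0, 0) / 6)
  have hexp6 : ∀ x, exp (L x / 6) ^ 6 = A x ^ 3 - B x ^ 2 := fun x => by
    rw [← exp_nat_mul, ← hexp]; congr 1; push_cast; ring
  have hk : k ^ 6 = 1 := by
    rw [div_pow, hexp6, hA0, hB0, div_eq_one_iff_eq]
    · linear_combination c0 ^ 6 * u0 ^ 2 * hv0
    · rw [← hA0, ← hB0]; exact sub_ne_zero.2 (h _)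
  have hk0 : k ≠ 0 := by rintro h; rw [h] at hk; norm_num at hk
  let c : ℝ × ℝ → ℂ := fun x => k * exp (L x / 6)
  have hcc : Continuous c := by fun_prop
  have hcne : ∀ x, c x ≠ 0 := fun x => mul_ne_zero hk0 (exp_ne_zero _)
  have hc6 : ∀ x, c x ^ 6 = A x ^ 3 - B x ^ 2 := fun x => by
    rw [mul_pow, hk, hexp6, one_mul]
  have hcat : c (0, 0) = c0 := by
    simp only [c, k]; rw [div_mul_cancel₀ _ (exp_ne_zero _)]
  let p : ℝ × ℝ → ℂ := fun x => A x / c x ^ 2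
  let q : ℝ × ℝ → ℂ := fun x => B x / c x ^ 3
  have hp : Continuous p := hA.div (hcc.pow 2) fun x => pow_ne_zero _ (hcne x)
  have hq : Continuous q := hB.div (hcc.pow 3) fun x => pow_ne_zero _ (hcne x)
  have hpq : ∀ x, p x ^ 3 - q x ^ 2 = 1 := fun x => by
    have h1 : p x ^ 3 - q x ^ 2 = (A x ^ 3 - B x ^ 2) / c x ^ 6 := by
      simp only [p, q]; have := hcne x; field_simp
    rw [h1, ← hc6, div_self (pow_ne_zero _ (hcne x))]
  obtain ⟨u, v, hu, hv, huv⟩ := exists_sign_lift (fun x => p x - 1) q (fun x => p x ^ 2 + p x + 1)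
    (by fun_prop) hq (by fun_prop) (fun x => by linear_combination hpq x) (fun x hx => by
      rw [sub_eq_zero.1 hx]; norm_num)
  have hlift : CuspLift A B c u v := by
    refine ⟨hcc, hu, hv, hcne, fun x => ?_, fun x => ?_, fun x => ?_⟩
    · rw [(huv x).1]; simp only [p]; have := hcne x; field_simp; ring
    · rw [(huv x).2.1]; simp only [q]; have := hcne x; field_simp
    · have e1 := (huv x).1
      rw [(huv x).2.2, show p x = 1 + u x ^ 2 by rw [e1]; ring]; ring
  have h1 : u (0, 0) ^ 2 = u0 ^ 2 := by
    have := (hlift.eq_A (0, 0)).symm.trans hA0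
    rw [hcat] at this
    linear_combination mul_left_cancel₀ (pow_ne_zero 2 hc0) this
  have h2 : u (0, 0) * v (0, 0) = u0 * v0 := by
    have := (hlift.eq_B (0, 0)).symm.trans hB0
    rw [hcat] at this
    exact mul_left_cancel₀ (pow_ne_zero 3 hc0) this
  have h3 : v (0, 0) ^ 2 = v0 ^ 2 := by
    rw [hlift.eq_v, hv0]; linear_combination (u (0, 0) ^ 2 + u0 ^ 2 + 3) * h1
  rcases sign_lift_unique (X := Unit) (fun _ => u (0, 0)) (fun _ => v (0, 0)) (fun _ => u0)
    (fun _ => v0) continuous_const continuous_const continuous_const continuous_const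
    (fun _ => hlift.u_ne_or _) (fun _ => h1) (fun _ => h2) (fun _ => h3) with e | e
  · exact ⟨c, u, v, hlift, hcat, (e ()).1.symm, (e ()).2.symm⟩
  · exact ⟨c, -u, -v, hlift.neg, hcat, (e ()).1.symm, (e ()).2.symm⟩

namespace CuspLift

theorem winding_ne {X : Type*} [TopologicalSpace X] {A B c u v : X → ℂ}
    (h : CuspLift A B c u v) (x : X) : v x + u x ^ 2 + 3 / 2 ≠ 0 := by
  intro h0
  have h1 : (v x + u x ^ 2 + 3 / 2) * (v x - u x ^ 2 - 3 / 2) = 3 / 4 := by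
    linear_combination h.eq_v x
  rw [h0] at h1
  norm_num at h1

variable {A B c u v : ℝ × ℝ → ℂ}

theorem periodic (h : CuspLift A B c u v) (T : ℝ) (hA : ∀ s τ, A (s + T, τ) = A (s, τ))
    (hB : ∀ s τ, B (s + T, τ) = B (s, τ)) (s τ : ℝ) :
    u (s + 12 * T, τ) = u (s, τ) ∧ v (s + 12 * T, τ) = v (s, τ) := by
  have h1 := h.comp (fun x : ℝ × ℝ => (x.1 + T, x.2)) (by fun_prop)
  obtain ⟨κ, hκ6, hκ⟩ := exists_root_of_unity_ratio c _ h.continuous_c h1.continuous_c h.c_ne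
    (fun x => by rw [h.pow_six, h1.pow_six]; simp [hA, hB])
  have hc1 : ∀ s τ, c (s + T, τ) = κ * c (s, τ) := fun s τ => hκ (s, τ)
  have hc6 : ∀ s τ, c (s + 6 * T, τ) = c (s, τ) := fun s τ => by
    rw [show s + 6 * T = s + T + T + T + T + T + T by ring]
    simp only [hc1]
    linear_combination c (s, τ) * hκ6
  have hA6 : ∀ s τ, A (s + 6 * T, τ) = A (s, τ) := fun s τ => by
    rw [show s + 6 * T = s + T + T + T + T + T + T by ring]; simp only [hA]
  have hB6 : ∀ s τ, B (s + 6 * T, τ) = B (s, τ) := fun s τ => by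
    rw [show s + 6 * T = s + T + T + T + T + T + T by ring]; simp only [hB]
  have h6 := h.comp (fun x : ℝ × ℝ => (x.1 + 6 * T, x.2)) (by fun_prop)
  have e1 : A ∘ (fun x : ℝ × ℝ => (x.1 + 6 * T, x.2)) = A := funext fun x => hA6 x.1 x.2
  have e2 : B ∘ (fun x : ℝ × ℝ => (x.1 + 6 * T, x.2)) = B := funext fun x => hB6 x.1 x.2
  have e3 : c ∘ (fun x : ℝ × ℝ => (x.1 + 6 * T, x.2)) = c := funext fun x => hc6 x.1 x.2
  rw [e1, e2, e3] at h6
  rw [show s + 12 * T = s + 6 * T + 6 * T by ring]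
  rcases h.eq_or_eq_neg h6 with ⟨a, b⟩ | ⟨a, b⟩
  · have a' : ∀ s τ, u (s + 6 * T, τ) = u (s, τ) := fun s τ => congrFun a (s, τ)
    have b' : ∀ s τ, v (s + 6 * T, τ) = v (s, τ) := fun s τ => congrFun b (s, τ)
    simp [a', b']
  · have a' : ∀ s τ, u (s + 6 * T, τ) = -u (s, τ) := fun s τ => congrFun a (s, τ)
    have b' : ∀ s τ, v (s + 6 * T, τ) = -v (s, τ) := fun s τ => congrFun b (s, τ)
    simp [a', b']

theorem exists_winding (h : CuspLift A B c u v) (T : ℝ) (hA : ∀ s τ, A (s + T, τ) = A (s, τ))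
    (hB : ∀ s τ, B (s + T, τ) = B (s, τ)) :
    ∃ (L : ℝ × ℝ → ℂ) (m : ℤ), Continuous L ∧ (∀ x, exp (L x) = v x + u x ^ 2 + 3 / 2) ∧
      ∀ s τ, L (s + 12 * T, τ) = L (s, τ) + m * (2 * Real.pi * I) := by
  have hu := h.continuous_u
  have hv := h.continuous_v
  obtain ⟨L, hL, hexp⟩ := exists_continuous_log (fun x => v x + u x ^ 2 + 3 / 2) (by fun_prop)
    h.winding_ne
  obtain ⟨m, hm⟩ := exists_int_period_log _ L hL hexp (12 * T) (fun s τ => by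
    simp only [(h.periodic T hA hB s τ).1, (h.periodic T hA hB s τ).2])
  exact ⟨L, m, hL, hexp, hm⟩

end CuspLift

theorem period_log_eq {f : ℝ → ℂ} {L L' : ℝ → ℂ} (hL : Continuous L) (hL' : Continuous L')
    (h : ∀ s, exp (L s) = f s) (h' : ∀ s, exp (L' s) = f s) (a b : ℝ) :
    L a - L b = L' a - L' b := by
  obtain ⟨n, hn⟩ := exists_int_of_exp_eq_one (fun s => L s - L' s) (by fun_prop) (fun s => by
    rw [exp_sub, h, h']
    exact div_self (by rw [← h]; exact exp_ne_zero _))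
  linear_combination hn a - hn b

/-- A loop that commutes, up to homotopy, with a loop reversing the sign of the lift
has winding number zero. -/
theorem CuspLift.winding_eq_zero {A B : ℝ × ℝ → ℂ} (hAc : Continuous A) (hBc : Continuous B)
    (hAB : ∀ x, A x ^ 3 ≠ B x ^ 2) (T : ℝ) (hA : ∀ s τ, A (s + T, τ) = A (s, τ))
    (hB : ∀ s τ, B (s + T, τ) = B (s, τ)) (hA1 : ∀ s, A (s, 1) = A (s, 0))
    (hB1 : ∀ s, B (s, 1) = B (s, 0)) {cg ug vg : ℝ → ℂ}
    (hg : CuspLift (fun τ => A (0, τ)) (fun τ => B (0, τ)) cg ug vg) (hc : cg 1 = cg 0)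
    (hu : ug 1 = -ug 0) (hv : vg 1 = -vg 0) {c u v : ℝ → ℂ}
    (h : CuspLift (fun s => A (s, 0)) (fun s => B (s, 0)) c u v) (hc0 : c 0 = cg 0)
    (hu0 : u 0 = ug 0) (hv0 : v 0 = vg 0) (L : ℝ → ℂ) (hL : Continuous L)
    (hexp : ∀ s, exp (L s) = v s + u s ^ 2 + 3 / 2) : L (12 * T) = L 0 := by
  obtain ⟨C, U, V, hl, hC0, hU0, hV0⟩ := exists_cuspLift A B hAc hBc hAB _ _ _ (hg.c_ne 0)
    (hg.eq_A 0) (hg.eq_B 0) (hg.eq_v 0)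
  obtain ⟨M, m, hM, hMexp, hm⟩ := hl.exists_winding T hA hB
  have hleft := hl.comp (fun τ : ℝ => ((0 : ℝ), τ)) (by fun_prop)
  have hbot := hl.comp (fun s : ℝ => (s, (0 : ℝ))) (by fun_prop)
  have htop := hl.comp (fun s : ℝ => (s, (1 : ℝ))) (by fun_prop)
  obtain ⟨l1, l2, l3⟩ := hg.unique hleft 0 hC0 hU0 hV0
  have hbt : (fun s : ℝ => A (s, 1)) = fun s => A (s, 0) := funext hA1
  have hbt' : (fun s : ℝ => B (s, 1)) = fun s => B (s, 0) := funext hB1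
  have hbotneg := hbot.neg
  have htop' : CuspLift (A ∘ fun s : ℝ => (s, (0 : ℝ))) (B ∘ fun s : ℝ => (s, (0 : ℝ)))
      (C ∘ fun s : ℝ => (s, (1 : ℝ))) (U ∘ fun s : ℝ => (s, (1 : ℝ)))
      (V ∘ fun s : ℝ => (s, (1 : ℝ))) := by
    have := htop
    rwa [show (A ∘ fun s : ℝ => (s, (1 : ℝ))) = (A ∘ fun s : ℝ => (s, (0 : ℝ))) from hbt,
      show (B ∘ fun s : ℝ => (s, (1 : ℝ))) = (B ∘ fun s : ℝ => (s, (0 : ℝ))) from hbt'] at this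
  obtain ⟨-, t2, t3⟩ := hbotneg.unique htop' 0
    (by have := congrFun l1 1; simp only [Function.comp_apply] at this ⊢; rw [this, hc, hC0])
    (by have := congrFun l2 1; simp only [Function.comp_apply, Pi.neg_apply] at this ⊢
        rw [this, hu, hU0])
    (by have := congrFun l3 1; simp only [Function.comp_apply, Pi.neg_apply] at this ⊢
        rw [this, hv, hV0])
  have t2' : ∀ s, U (s, 1) = -U (s, 0) := fun s => congrFun t2 s
  have t3' : ∀ s, V (s, 1) = -V (s, 0) := fun s => congrFun t3 s
  have hprod : ∀ s, exp (M (s, 1) + M (s, 0) - (M (0, 1) + M (0, 0))) = 1 := by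
    have : ∀ s, exp (M (s, 1) + M (s, 0)) = -3 / 4 := fun s => by
      rw [exp_add, hMexp, hMexp, t2', t3']
      linear_combination -(hl.eq_v (s, 0))
    intro s
    rw [exp_sub, this, this]; norm_num
  obtain ⟨n, hn⟩ := exists_int_of_exp_eq_one _ (by fun_prop) hprod
  have e1 := hn (12 * T)
  have e0 := hn 0
  have m1 := hm 0 1
  have m0 := hm 0 0
  rw [zero_add] at m1 m0
  have hm0 : (m : ℂ) * (2 * Real.pi * I) = 0 := by
    linear_combination (1 / 2) * e1 - (1 / 2) * e0 - (1 / 2) * m1 - (1 / 2) * m0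
  obtain ⟨-, b2, b3⟩ := h.unique hbot 0 (by rw [hc0]; exact hC0) (by rw [hu0]; exact hU0)
    (by rw [hv0]; exact hV0)
  have := period_log_eq (f := fun s => v s + u s ^ 2 + 3 / 2) (L' := fun s => M (s, 0)) hL
    (by fun_prop) hexp (fun s => by rw [hMexp, ← b2, ← b3]; rfl) (12 * T) 0
  rw [m0, hm0] at this
  linear_combination this

theorem exists_sqrt_affine (α β : ℂ) :
    ∃ s : ℝ → ℂ, Continuous s ∧ ∀ t : ℝ, s t ^ 2 = α + β * t := by
  by_cases hβ : β = 0
  · obtain ⟨z, hz⟩ := IsAlgClosed.exists_pow_nat_eq α two_pos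
    exact ⟨fun _ => z, continuous_const, fun t => by rw [hz, hβ]; ring⟩
  obtain ⟨b, hb⟩ := IsAlgClosed.exists_pow_nat_eq β two_pos
  let ζ := α / β
  have hζ : ∀ t : ℝ, α + β * t = β * (t + ζ) := fun t => by simp only [ζ]; field_simp; ring
  by_cases him : ζ.im = 0
  · obtain ⟨y, hre⟩ : ∃ y : ℝ, ζ = y := ⟨ζ.re, by apply Complex.ext <;> simp [him]⟩
    refine ⟨fun t => b * (Real.sqrt (t + y) + I * Real.sqrt (-(t + y))), by fun_prop,
      fun t => ?_⟩
    rw [hζ, mul_pow, hb, hre]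
    congr 1
    rcases le_total 0 (t + y) with h | h
    · rw [Real.sqrt_eq_zero_of_nonpos (neg_nonpos.2 h)]
      simp only [ofReal_zero, mul_zero, add_zero]
      rw [← ofReal_pow, Real.sq_sqrt h]; push_cast; rfl
    · rw [Real.sqrt_eq_zero_of_nonpos h]
      simp only [ofReal_zero, zero_add, mul_pow, I_sq]
      rw [← ofReal_pow, Real.sq_sqrt (neg_nonneg.2 h)]; push_cast; ring
  · refine ⟨fun t => b * (t + ζ) ^ (1 / 2 : ℂ), ?_, fun t => ?_⟩
    · refine continuous_const.mul (continuous_iff_continuousAt.2 fun t => ?_)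
      refine ContinuousAt.cpow (by fun_prop) continuousAt_const (Or.inr ?_)
      simpa using him
    · rw [hζ, mul_pow, hb, ← cpow_nat_mul]
      norm_num

/-- The deck transformation of the curve `v ^ 2 = u ^ 4 + 3 * u ^ 2 + 3` is realised by a path. -/
theorem exists_path_neg (u0 v0 : ℂ) (h0 : v0 ^ 2 = u0 ^ 4 + 3 * u0 ^ 2 + 3) :
    ∃ U V : ℝ → ℂ, Continuous U ∧ Continuous V ∧ (∀ t, V t ^ 2 = U t ^ 4 + 3 * U t ^ 2 + 3) ∧
      U 0 = u0 ∧ V 0 = v0 ∧ U 1 = -u0 ∧ V 1 = -v0 := by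
  let E := {x : ℂ × ℂ // x.2 ^ 2 = x.1 ^ 4 + 3 * x.1 ^ 2 + 3}
  obtain ⟨w, hw⟩ := IsAlgClosed.exists_pow_nat_eq (-3 : ℂ) two_pos
  obtain ⟨r1, hr1⟩ := IsAlgClosed.exists_pow_nat_eq ((-3 + w) / 2) two_pos
  obtain ⟨r2, hr2⟩ := IsAlgClosed.exists_pow_nat_eq ((-3 - w) / 2) two_pos
  have hfac : ∀ z : ℂ, z ^ 4 + 3 * z ^ 2 + 3 = (z - r1) * (z + r1) * ((z - r2) * (z + r2)) := by
    intro z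
    linear_combination (z ^ 2 - r2 ^ 2) * hr1 + (z ^ 2 - (-3 + w) / 2) * hr2 + (1 / 4) * hw
  have hbase : (0 : ℂ) ^ 2 = r1 ^ 4 + 3 * r1 ^ 2 + 3 := by rw [hfac]; ring
  have key : ∀ x : E, Joined x ⟨(r1, 0), hbase⟩ := by
    rintro ⟨⟨r, v⟩, hx⟩
    dsimp only at hx
    obtain ⟨s1, hs1, e1⟩ := exists_sqrt_affine (r - r1) (r1 - r)
    obtain ⟨s2, hs2, e2⟩ := exists_sqrt_affine (r + r1) (r1 - r)
    obtain ⟨s3, hs3, e3⟩ := exists_sqrt_affine (r - r2) (r1 - r)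
    obtain ⟨s4, hs4, e4⟩ := exists_sqrt_affine (r + r2) (r1 - r)
    let W : ℝ → ℂ := fun t => s1 t * s2 t * (s3 t * s4 t)
    let Z : ℝ → ℂ := fun t => r + (r1 - r) * t
    have hWZ : ∀ t, W t ^ 2 = Z t ^ 4 + 3 * Z t ^ 2 + 3 := fun t => by
      rw [hfac]
      simp only [W, Z, mul_pow, e1, e2, e3, e4]; ring
    have hW1 : W 1 = 0 := by
      have := e1 1
      have : s1 1 = 0 := by simpa using this
      simp [W, this]
    have hWc : Continuous W := by fun_prop
    have hZc : Continuous Z := by fun_prop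
    have hv : W 0 ^ 2 = v ^ 2 := by rw [hWZ, hx]; simp [Z]
    have : ∃ ε : ℂ, ε ^ 2 = 1 ∧ ε * W 0 = v := by
      rcases sq_eq_sq_iff_eq_or_eq_neg.1 hv with e | e
      · exact ⟨1, by norm_num, by rw [e, one_mul]⟩
      · exact ⟨-1, by norm_num, by rw [e]; ring⟩
    obtain ⟨ε, hε, hε'⟩ := this
    refine ⟨⟨⟨fun t => ⟨(Z t, ε * W t), ?_⟩, ?_⟩, ?_, ?_⟩⟩
    · rw [← hWZ, mul_pow, hε, one_mul]
    · exact Continuous.subtype_mk (by fun_prop) _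
    · simp [Z, hε']
    · simp [Z, hW1]
  have hneg : (-v0) ^ 2 = (-u0) ^ 4 + 3 * (-u0) ^ 2 + 3 := by linear_combination h0
  obtain ⟨γ⟩ := (key ⟨(u0, v0), h0⟩).trans (key ⟨(-u0, -v0), hneg⟩).symm
  refine ⟨fun t => (γ.extend t).1.1, fun t => (γ.extend t).1.2, ?_, ?_, fun t => (γ.extend t).2,
    by simp, by simp, by simp, by simp⟩
  · exact continuous_fst.comp (continuous_subtype_val.comp γ.continuous_extend)
  · exact continuous_snd.comp (continuous_subtype_val.comp γ.continuous_extend)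

theorem ratio_mem_slitPlane {g p ξ : ℂ} (hξ : ‖ξ‖ = 1 / 1000)
    (hp : p ^ 3 * (exp ξ - 1) = exp ξ) (hg : 3 / 4 < ‖g‖) (hgp : g ^ 2 - 3 / 4 = (2 * p + 1) * g) :
    g ^ 3 * ξ / 8 ∈ slitPlane := by
  have hξ0 : ξ ≠ 0 := by rintro rfl; norm_num at hξ
  have hp0 : p ≠ 0 := by
    rintro rfl
    exact exp_ne_zero ξ (by rw [← hp]; ring)
  have hg0 : g ≠ 0 := by rintro rfl; norm_num at hg
  obtain ⟨a, ha, haξ⟩ : ∃ a : ℂ, exp ξ - 1 = ξ * (1 + a) ∧ ‖a‖ ≤ 1 / 1000 := by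
    refine ⟨(exp ξ - 1 - ξ) / ξ, by field_simp; ring, ?_⟩
    have := norm_exp_sub_one_sub_id_le (x := ξ) (by rw [hξ]; norm_num)
    rw [norm_div, hξ, div_le_iff₀ (by norm_num)]
    rw [hξ] at this
    linarith
  obtain ⟨b, hb, hbn⟩ : ∃ b : ℂ, p ^ 3 * ξ = 1 + b ∧ ‖b‖ ≤ 1 / 300 := by
    refine ⟨p ^ 3 * ξ - 1, by ring, ?_⟩
    have h1 : (p ^ 3 * ξ - 1) * (1 + a) = ξ + ξ * a - a := by
      have h2 : exp ξ = 1 + ξ * (1 + a) := by rw [← ha]; ring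
      rw [ha, h2] at hp
      linear_combination hp
    have h2 : ‖(p ^ 3 * ξ - 1)‖ * ‖1 + a‖ ≤ 1 / 1000 + 1 / 1000 * (1 / 1000) + 1 / 1000 := by
      rw [← norm_mul, h1]
      refine (norm_sub_le _ _).trans (add_le_add ((norm_add_le _ _).trans ?_) haξ)
      rw [norm_mul, hξ]
      linarith
    have h3 : 1 - 1 / 1000 ≤ ‖1 + a‖ := by
      have := norm_sub_le (1 + a) a
      rw [add_sub_cancel_right, norm_one] at this
      linarith
    nlinarith [norm_nonneg (p ^ 3 * ξ - 1)]
  have hpn : 9 ≤ ‖p‖ := by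
    by_contra hlt
    push Not at hlt
    have h1 : ‖p‖ ^ 3 * (1 / 1000) = ‖1 + b‖ := by rw [← hb, norm_mul, norm_pow, hξ]
    have h2 : 1 - 1 / 300 ≤ ‖1 + b‖ := by
      have := norm_sub_le (1 + b) b
      rw [add_sub_cancel_right, norm_one] at this
      linarith
    have h3 : ‖p‖ ^ 3 ≤ 9 ^ 3 := pow_le_pow_left₀ (norm_nonneg _) hlt.le 3
    norm_num at h3
    linarith
  obtain ⟨e, he, hen⟩ : ∃ e : ℂ, g = 2 * p * (1 + e) ∧ ‖e‖ ≤ 1 / 9 := by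
    refine ⟨(1 + 3 / (4 * g)) / (2 * p), ?_, ?_⟩
    · field_simp
      linear_combination (4 : ℂ) * hgp
    · rw [norm_div, div_le_iff₀ (norm_pos_iff.2 (mul_ne_zero two_ne_zero hp0)), norm_mul]
      have h1 : ‖3 / (4 * g)‖ ≤ 1 := by
        rw [norm_div, div_le_one (norm_pos_iff.2 (mul_ne_zero (by norm_num : (4 : ℂ) ≠ 0) hg0)), norm_mul]
        norm_num; linarith
      have h2 := norm_add_le 1 (3 / (4 * g))
      rw [norm_one] at h2
      have h3 : ‖(2 : ℂ)‖ = 2 := by norm_num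
      rw [h3]; linarith
  have hW : g ^ 3 * ξ / 8 = (1 + e) ^ 3 * (1 + b) := by rw [← hb, he]; ring
  rw [hW, mem_slitPlane_iff]
  left
  have h1 : ‖(1 + e) ^ 3 * (1 + b) - 1‖ < 1 := by
    have : (1 + e) ^ 3 * (1 + b) - 1 = (e * 3 + e ^ 2 * 3 + e ^ 3) * (1 + b) + b := by ring
    rw [this]
    have h2 : ‖e * 3 + e ^ 2 * 3 + e ^ 3‖ ≤ 1 / 2 := by
      have h4 : ‖e‖ ^ 2 ≤ (1 / 9) ^ 2 := pow_le_pow_left₀ (norm_nonneg _) hen 2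
      have h5 : ‖e‖ ^ 3 ≤ (1 / 9) ^ 3 := pow_le_pow_left₀ (norm_nonneg _) hen 3
      refine (norm_add₃_le).trans ?_
      simp only [norm_mul, norm_pow]
      have h3 : ‖(3 : ℂ)‖ = 3 := by norm_num
      rw [h3]; norm_num at h4 h5; linarith
    have h3 : ‖1 + b‖ ≤ 2 := by
      refine (norm_add_le _ _).trans ?_
      rw [norm_one]; linarith
    have h4 : ‖1 + b‖ ≤ 1 + 1 / 300 := by
      refine (norm_add_le _ _).trans ?_
      rw [norm_one]; linarith
    refine (norm_add_le _ _).trans_lt ?_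
    rw [norm_mul]
    nlinarith [norm_nonneg (1 + b), norm_nonneg (e * 3 + e ^ 2 * 3 + e ^ 3)]
  have h2 := (abs_re_le_norm _).trans_lt h1
  rw [abs_lt, sub_re, one_re] at h2
  linarith [h2.1]

theorem norm_ne_one_of_large {g p ξ : ℂ} (hξ : ‖ξ‖ = 1 / 1000)
    (hp : p ^ 3 * (exp ξ - 1) = exp ξ) (hgp : g ^ 2 - 3 / 4 = (2 * p + 1) * g) : ‖g‖ ≠ 1 := by
  intro hg
  have hξ0 : ξ ≠ 0 := by rintro rfl; norm_num at hξ
  have h1 : ‖2 * p + 1‖ ≤ 2 := by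
    have : ‖2 * p + 1‖ * ‖g‖ ≤ 2 := by
      rw [← norm_mul, ← hgp]
      refine (norm_sub_le _ _).trans ?_
      rw [norm_pow, hg]; norm_num
    rwa [hg, mul_one] at this
  have h2 : ‖p‖ ≤ 3 / 2 := by
    have h3 : ‖2 * p‖ ≤ 3 := by
      have := norm_sub_le (2 * p + 1) 1
      rw [add_sub_cancel_right, norm_one] at this
      linarith
    rw [norm_mul] at h3
    norm_num at h3; linarith
  have h3 : ‖exp ξ - 1‖ ≤ 2 / 1000 := by
    have := norm_exp_sub_one_le (x := ξ) (by rw [hξ]; norm_num)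
    rw [hξ] at this; linarith
  have h4 : ‖p‖ ^ 3 * ‖exp ξ - 1‖ = ‖exp ξ‖ := by
    rw [← norm_pow, ← norm_mul, hp]
  have h5 : 1 - 2 / 1000 ≤ ‖exp ξ‖ := by
    have := norm_sub_le (exp ξ) (exp ξ - 1)
    rw [sub_sub_cancel, norm_one] at this
    linarith
  have h6 : ‖p‖ ^ 3 ≤ (3 / 2) ^ 3 := pow_le_pow_left₀ (norm_nonneg _) h2 3
  nlinarith [norm_nonneg (exp ξ - 1), pow_nonneg (norm_nonneg p) 3]

theorem meridional_winding_eq_zero_of_large {g p ξ ℓ : ℝ → ℂ} {n : ℤ} {T : ℝ} (hT : T ≠ 0)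
    (hgc : Continuous g) (hℓc : Continuous ℓ)
    (hξ : ∀ s : ℝ, ξ s = 1 / 1000 * exp (n * s * I))
    (hp : ∀ s, p s ^ 3 * (exp (ξ s) - 1) = exp (ξ s)) (hg : ∀ s, 3 / 4 < ‖g s‖)
    (hgp : ∀ s, g s ^ 2 - 3 / 4 = (2 * p s + 1) * g s) (hℓ : ∀ s, exp (ℓ s) = g s)
    (h : ℓ T = ℓ 0) (hξT : ξ T = ξ 0) : n = 0 := by
  have hξn : ∀ s, ‖ξ s‖ = 1 / 1000 := fun s => by
    rw [hξ, norm_mul, show (n * s * I : ℂ) = ((n * s : ℝ) : ℂ) * I by push_cast; ring,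
      norm_exp_ofReal_mul_I]
    norm_num
  have hξc : Continuous ξ := by rw [funext hξ]; fun_prop
  have hslit : ∀ s, g s ^ 3 * ξ s / 8 ∈ slitPlane := fun s =>
    ratio_mem_slitPlane (hξn s) (hp s) (hg s) (hgp s)
  have hlogc : Continuous fun s => log (g s ^ 3 * ξ s / 8) :=
    Continuous.clog (by fun_prop) hslit
  obtain ⟨m, hm⟩ := exists_int_of_exp_eq_one
    (fun s : ℝ => 3 * ℓ s + n * s * I - log (g s ^ 3 * ξ s / 8) - log 8000) (by fun_prop)
    (fun s => by
      have h1 : exp (3 * ℓ s) = g s ^ 3 := by rw [← hℓ, ← exp_nat_mul]; norm_num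
      have h2 := slitPlane_ne_zero (hslit s)
      rw [exp_sub, exp_sub, exp_add, exp_log h2, h1, exp_log (by norm_num)]
      have h3 : g s ≠ 0 := by rw [← hℓ]; exact exp_ne_zero _
      have h4 := exp_ne_zero (n * s * I)
      rw [hξ]
      field_simp
      norm_num)
  have e1 := hm T
  have e0 := hm 0
  have hgT : g T = g 0 := by rw [← hℓ, ← hℓ, h]
  simp only [hgT, hξT, h] at e1
  have : (n : ℂ) * (T * I) = 0 := by
    simp only [ofReal_zero] at e0
    linear_combination e1 - e0
  rcases mul_eq_zero.1 this with h' | h'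
  · exact_mod_cast h'
  · exfalso
    rcases mul_eq_zero.1 h' with h' | h'
    · exact hT (by exact_mod_cast h')
    · exact I_ne_zero h'

theorem meridional_winding_eq_zero {g p ξ ℓ : ℝ → ℂ} {n : ℤ} {T : ℝ} (hT : T ≠ 0)
    (hgc : Continuous g) (hℓc : Continuous ℓ)
    (hξ : ∀ s : ℝ, ξ s = 1 / 1000 * exp (n * s * I))
    (hp : ∀ s, p s ^ 3 * (exp (ξ s) - 1) = exp (ξ s))
    (hgp : ∀ s, g s ^ 2 - 3 / 4 = (2 * p s + 1) * g s) (hℓ : ∀ s, exp (ℓ s) = g s)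
    (h : ℓ T = ℓ 0) (hξT : ξ T = ξ 0) : n = 0 := by
  have hξn : ∀ s, ‖ξ s‖ = 1 / 1000 := fun s => by
    rw [hξ, norm_mul, show (n * s * I : ℂ) = ((n * s : ℝ) : ℂ) * I by push_cast; ring,
      norm_exp_ofReal_mul_I]
    norm_num
  have hne : ∀ s, ‖g s‖ ≠ 1 := fun s => norm_ne_one_of_large (hξn s) (hp s) (hgp s)
  have hg0 : ∀ s, g s ≠ 0 := fun s => by rw [← hℓ]; exact exp_ne_zero _
  by_cases hall : ∀ s, 1 < ‖g s‖
  · exact meridional_winding_eq_zero_of_large hT hgc hℓc hξ hp (fun s => by linarith [hall s])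
      hgp hℓ h hξT
  · have hlt : ∀ s, ‖g s‖ < 1 := by
      push Not at hall
      obtain ⟨s0, hs0⟩ := hall
      intro s
      by_contra hs
      push Not at hs
      have := mem_range_of_exists_le_of_exists_ge (f := fun s => ‖g s‖) (c := 1) (by fun_prop)
        ⟨s0, hs0⟩ ⟨s, hs⟩
      obtain ⟨s1, hs1⟩ := this
      exact hne s1 hs1
    refine meridional_winding_eq_zero_of_large (g := fun s => -(3 / 4) / g s) (p := p)
      (ℓ := fun s => log (-(3 / 4)) - ℓ s) hT (continuous_const.div hgc hg0) (by fun_prop) hξ hp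
      (fun s => ?_) (fun s => ?_) (fun s => ?_) (by simp only [h]) hξT
    · rw [norm_div, lt_div_iff₀ (norm_pos_iff.2 (hg0 s))]
      have : ‖(-(3 / 4) : ℂ)‖ = 3 / 4 := by norm_num
      rw [this]
      linarith [hlt s]
    · have := hg0 s
      field_simp
      linear_combination (-4 : ℂ) * hgp s
    · rw [exp_sub, hℓ, exp_log (by norm_num)]

/-- The map `(c, d)` from the torus to `ℝ × ℂ` minus the origin has degree `n`, expressed
through the Euler class of the pulled back Hopf bundle. -/
def HasDegree (c : ℝ × ℝ → ℝ) (d : ℝ × ℝ → ℂ) (n : ℤ) : Prop :=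
  ∃ (ψ₁ ψ₂ : ℝ × ℝ → ℂ) (r : ℝ × ℝ → ℝ) (κ : ℂ) (l : ℤ), Continuous ψ₁ ∧ Continuous ψ₂ ∧
    κ ≠ 0 ∧ (∀ x, ψ₁ x = 0 → ψ₂ x ≠ 0) ∧ (∀ x, 0 < r x) ∧
    (∀ x, c x = r x * (normSq (ψ₁ x) - normSq (ψ₂ x))) ∧
    (∀ x, d x = r x * (2 * (conj (ψ₁ x) * ψ₂ x))) ∧
    (∀ s σ, ψ₁ (s + 2 * Real.pi, σ) = ψ₁ (s, σ) ∧ ψ₂ (s + 2 * Real.pi, σ) = ψ₂ (s, σ)) ∧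
    (∀ s σ, ψ₁ (s, σ + 2 * Real.pi) = κ * exp (I * (n * s + l * σ)) * ψ₁ (s, σ) ∧
      ψ₂ (s, σ + 2 * Real.pi) = κ * exp (I * (n * s + l * σ)) * ψ₂ (s, σ))

theorem spinor_parallel {r r' : ℝ} {a b a' b' : ℂ} (hr : 0 < r) (hr' : 0 < r')
    (h1 : r * (normSq a - normSq b) = r' * (normSq a' - normSq b'))
    (h2 : (r : ℂ) * (2 * (conj a * b)) = r' * (2 * (conj a' * b'))) (h0 : a = 0 → b ≠ 0) :
    a * b' = b * a' := by
  have hn : r * (normSq a * normSq b) * r = r' * (normSq a' * normSq b') * r' := by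
    have := congrArg normSq h2
    simp only [normSq_mul, normSq_ofReal, normSq_conj] at this
    have h4 : normSq (2 : ℂ) = 4 := by norm_num [normSq_apply]
    rw [h4] at this
    linarith
  have hN : r * (normSq a + normSq b) = r' * (normSq a' + normSq b') := by
    have : (r * (normSq a + normSq b)) ^ 2 = (r' * (normSq a' + normSq b')) ^ 2 := by
      have e1 := congrArg (fun x => x ^ 2) h1
      linear_combination e1 + 4 * hn
    refine (pow_left_inj₀ ?_ ?_ two_ne_zero).1 this
    · exact mul_nonneg hr.le (add_nonneg (normSq_nonneg _) (normSq_nonneg _))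
    · exact mul_nonneg hr'.le (add_nonneg (normSq_nonneg _) (normSq_nonneg _))
  have ha : r * normSq a = r' * normSq a' := by linarith
  have hb : r * normSq b = r' * normSq b' := by linarith
  have ha' : (r : ℂ) * (conj a * a) = r' * (conj a' * a') := by
    rw [← normSq_eq_conj_mul_self, ← normSq_eq_conj_mul_self]; exact_mod_cast ha
  have hb' : (r : ℂ) * (conj b * b) = r' * (conj b' * b') := by
    rw [← normSq_eq_conj_mul_self, ← normSq_eq_conj_mul_self]; exact_mod_cast hb
  have h2' : (r : ℂ) * (conj a * b) = r' * (conj a' * b') := by linear_combination (1 / 2) * h2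
  have h3 : (r : ℂ) * (a * conj b) = r' * (a' * conj b') := by
    have := congrArg conj h2'
    simpa using this
  have hrc : (r : ℂ) ≠ 0 := by exact_mod_cast hr.ne'
  by_cases h : a = 0
  · have hb0 := h0 h
    have : (r : ℂ) * conj b * (a * b' - b * a') = 0 := by
      linear_combination b' * h3 - a' * hb'
    have := (mul_eq_zero.1 this).resolve_left (mul_ne_zero hrc (by simpa using hb0))
    exact sub_eq_zero.1 this
  · have : (r : ℂ) * conj a * (a * b' - b * a') = 0 := by
      linear_combination b' * ha' - a' * h2'
    have := (mul_eq_zero.1 this).resolve_left (mul_ne_zero hrc (by simpa using h))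
    exact sub_eq_zero.1 this

theorem HasDegree.unique {c : ℝ × ℝ → ℝ} {d : ℝ × ℝ → ℂ} {n n' : ℤ} (h : HasDegree c d n)
    (h' : HasDegree c d n') : n = n' := by
  obtain ⟨a, b, r, κ, l, ha, hb, hκ, h0, hr, hc, hd, hs, hσ⟩ := h
  obtain ⟨a', b', r', κ', l', ha', hb', hκ', h0', hr', hc', hd', hs', hσ'⟩ := h'
  have hpar : ∀ x, a x * b' x = b x * a' x := fun x =>
    spinor_parallel (hr x) (hr' x) ((hc x).symm.trans (hc' x)) ((hd x).symm.trans (hd' x)) (h0 x)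
  let N : ℝ × ℝ → ℂ := fun x => conj (a x) * a x + conj (b x) * b x
  have hN : ∀ x, N x ≠ 0 := fun x hx => by
    have h1 : normSq (a x) + normSq (b x) = 0 := by
      simp only [N, ← normSq_eq_conj_mul_self] at hx
      exact_mod_cast hx
    have h2 : normSq (a x) = 0 := by linarith [normSq_nonneg (a x), normSq_nonneg (b x)]
    have h3 : normSq (b x) = 0 := by linarith [normSq_nonneg (a x), normSq_nonneg (b x)]
    exact h0 x (normSq_eq_zero.1 h2) (normSq_eq_zero.1 h3)
  have hNc : Continuous N := by
    simp only [N]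
    exact ((continuous_conj.comp ha).mul ha).add ((continuous_conj.comp hb).mul hb)
  let g : ℝ × ℝ → ℂ := fun x => (conj (a x) * a' x + conj (b x) * b' x) / N x
  have hgc : Continuous g :=
    (((continuous_conj.comp ha).mul ha').add ((continuous_conj.comp hb).mul hb')).div hNc hN
  have hga : ∀ x, a' x = g x * a x := fun x => by
    simp only [g]
    rw [div_mul_eq_mul_div, eq_div_iff (hN x)]
    simp only [N]
    linear_combination (-conj (b x)) * hpar x
  have hgb : ∀ x, b' x = g x * b x := fun x => by
    simp only [g]
    rw [div_mul_eq_mul_div, eq_div_iff (hN x)]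
    simp only [N]
    linear_combination conj (a x) * hpar x
  have hg0 : ∀ x, g x ≠ 0 := fun x hx => by
    refine h0' x ?_ ?_
    · rw [hga, hx, zero_mul]
    · rw [hgb, hx, zero_mul]
  have cancel : ∀ x (z w : ℂ), z * a x = w * a x → z * b x = w * b x → z = w := by
    intro x z w h1 h2
    by_cases h : a x = 0
    · exact mul_right_cancel₀ (h0 x h) h2
    · exact mul_right_cancel₀ h h1
  have hgs : ∀ s σ, g (s + 2 * Real.pi, σ) = g (s, σ) := fun s σ => by
    apply cancel (s, σ)
    · rw [← hga, ← (hs' s σ).1, hga, (hs s σ).1]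
    · rw [← hgb, ← (hs' s σ).2, hgb, (hs s σ).2]
  have hgσ : ∀ s σ, g (s, σ + 2 * Real.pi) * (κ * exp (I * (n * s + l * σ))) =
      (κ' * exp (I * (n' * s + l' * σ))) * g (s, σ) := fun s σ => by
    apply cancel (s, σ)
    · rw [mul_assoc, mul_assoc (κ' * _), ← hga, ← (hσ' s σ).1, hga, (hσ s σ).1]
    · rw [mul_assoc, mul_assoc (κ' * _), ← hgb, ← (hσ' s σ).2, hgb, (hσ s σ).2]
  obtain ⟨L, hL, hexp⟩ := exists_continuous_log g hgc hg0
  obtain ⟨m, hm⟩ := exists_int_period_log g L hL hexp _ hgs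
  obtain ⟨k, hk⟩ := exists_int_of_exp_eq_one (fun x : ℝ × ℝ =>
    L (x.1, x.2 + 2 * Real.pi) - L x + I * (n * x.1 + l * x.2) - I * (n' * x.1 + l' * x.2) -
      log (κ' / κ)) (by fun_prop) (fun x => by
      rw [exp_sub, exp_sub, exp_add, exp_sub, exp_log (div_ne_zero hκ' hκ), hexp, hexp]
      have e1 := hgσ x.1 x.2
      have e2 : g (x.1, x.2) ≠ 0 := hg0 x
      have e3 := exp_ne_zero (I * (n' * x.1 + l' * x.2))
      have e4 : g x = g (x.1, x.2) := rfl
      rw [e4]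
      generalize exp (I * (n' * x.1 + l' * x.2)) = E' at *
      generalize exp (I * (n * x.1 + l * x.2)) = E at *
      generalize g (x.1, x.2) = g₀ at *
      generalize g (x.1, x.2 + 2 * Real.pi) = g₁ at *
      field_simp
      linear_combination e1)
  have k1 := hk (2 * Real.pi, 0)
  have k0 := hk (0, 0)
  have m1 := hm 0 (2 * Real.pi)
  have m0 := hm 0 0
  simp only [zero_add, ofReal_zero, mul_zero, add_zero] at k1 k0 m1 m0
  push_cast at k1
  have : (n - n' : ℂ) * (2 * Real.pi * I) = 0 := by
    linear_combination k1 - k0 - m1 + m0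
  have := (mul_eq_zero.1 this).resolve_right (by simp [Real.pi_ne_zero])
  exact_mod_cast sub_eq_zero.1 this

theorem HasDegree.mirror {c : ℝ × ℝ → ℝ} {d : ℝ × ℝ → ℂ} {n : ℤ} (h : HasDegree c d n) :
    HasDegree (fun x => -c x) d (-n) := by
  obtain ⟨a, b, r, κ, l, ha, hb, hκ, h0, hr, hc, hd, hs, hσ⟩ := h
  refine ⟨fun x => conj (b x), fun x => conj (a x), r, conj κ, -l, continuous_conj.comp hb,
    continuous_conj.comp ha, by simpa using hκ, fun x hx hx' => ?_, hr, fun x => ?_, fun x => ?_,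
    fun s σ => ?_, fun s σ => ?_⟩
  · exact h0 x (by simpa using hx') (by simpa using hx)
  · beta_reduce
    rw [hc, normSq_conj, normSq_conj]; ring
  · beta_reduce
    rw [hd, conj_conj]; ring
  · beta_reduce
    rw [(hs s σ).1, (hs s σ).2]; exact ⟨rfl, rfl⟩
  · have : conj (exp (I * (n * s + l * σ))) = exp (I * ((-n : ℤ) * s + (-l : ℤ) * σ)) := by
      rw [← exp_conj]
      congr 1
      simp
      ring
    beta_reduce
    rw [(hσ s σ).1, (hσ s σ).2]
    simp only [map_mul, this]
    exact ⟨trivial, trivial⟩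

theorem HasDegree.of_dot_pos {c c' : ℝ × ℝ → ℝ} {d d' : ℝ × ℝ → ℂ} {n : ℤ}
    (h : HasDegree c d n) (hc' : Continuous c') (hd' : Continuous d')
    (hcs : ∀ s σ, c' (s + 2 * Real.pi, σ) = c' (s, σ))
    (hds : ∀ s σ, d' (s + 2 * Real.pi, σ) = d' (s, σ))
    (hcσ : ∀ s σ, c' (s, σ + 2 * Real.pi) = c' (s, σ))
    (hdσ : ∀ s σ, d' (s, σ + 2 * Real.pi) = d' (s, σ))
    (hdot : ∀ x, 0 < c x * c' x + (conj (d x) * d' x).re) : HasDegree c' d' n := by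
  obtain ⟨a, b, r, κ, l, ha, hb, hκ, h0, hr, hc, hd, hs, hσ⟩ := h
  let R : ℝ × ℝ → ℝ := fun x => Real.sqrt (c' x ^ 2 + normSq (d' x))
  have hRc : Continuous R := by
    have := continuous_normSq.comp hd'
    simp only [R]
    fun_prop
  have hR : ∀ x, R x ^ 2 = c' x ^ 2 + normSq (d' x) := fun x =>
    Real.sq_sqrt (add_nonneg (sq_nonneg _) (normSq_nonneg _))
  have hRC : ∀ x, (R x : ℂ) ^ 2 = c' x ^ 2 + conj (d' x) * d' x := fun x => by
    rw [← normSq_eq_conj_mul_self]; exact_mod_cast hR x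
  let Q : ℝ × ℝ → ℝ := fun x => R x * (normSq (a x) + normSq (b x)) +
    c' x * (normSq (a x) - normSq (b x)) + 2 * (a x * conj (b x) * d' x).re
  have hQ : ∀ x, 0 < Q x := fun x => by
    have h1 := hdot x
    rw [hc, hd] at h1
    have h2 : (conj ((r x : ℂ) * (2 * (conj (a x) * b x))) * d' x).re =
        r x * (2 * (a x * conj (b x) * d' x).re) := by
      simp
      ring
    rw [h2] at h1
    have h3 : 0 < r x * (c' x * (normSq (a x) - normSq (b x)) +
        2 * (a x * conj (b x) * d' x).re) := by linarith
    have h4 := pos_of_mul_pos_right h3 (hr x).le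
    have h5 : 0 ≤ R x * (normSq (a x) + normSq (b x)) :=
      mul_nonneg (Real.sqrt_nonneg _) (add_nonneg (normSq_nonneg _) (normSq_nonneg _))
    simp only [Q]; linarith
  have hQC : ∀ x, (Q x : ℂ) = R x * (conj (a x) * a x + conj (b x) * b x) +
      c' x * (conj (a x) * a x - conj (b x) * b x) +
      (a x * conj (b x) * d' x + conj (a x) * b x * conj (d' x)) := fun x => by
    have : ((2 * (a x * conj (b x) * d' x).re : ℝ) : ℂ) =
        a x * conj (b x) * d' x + conj (a x) * b x * conj (d' x) := by
      rw [← add_conj]; simp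
    simp only [Q]
    rw [ofReal_add, this, ← normSq_eq_conj_mul_self, ← normSq_eq_conj_mul_self]
    push_cast; ring
  let a' : ℝ × ℝ → ℂ := fun x => (R x + c' x) * a x + conj (d' x) * b x
  let b' : ℝ × ℝ → ℂ := fun x => d' x * a x + (R x - c' x) * b x
  have hconja : ∀ x, conj (a' x) = (R x + c' x) * conj (a x) + d' x * conj (b x) := fun x => by
    simp [a']
  have hconjb : ∀ x, conj (b' x) = conj (d' x) * conj (a x) + (R x - c' x) * conj (b x) :=
    fun x => by simp [b']
  have e1 : ∀ x, normSq (a' x) - normSq (b' x) = 2 * Q x * c' x := fun x => by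
    have : (((normSq (a' x) - normSq (b' x) : ℝ)) : ℂ) = ((2 * Q x * c' x : ℝ) : ℂ) := by
      push_cast
      rw [normSq_eq_conj_mul_self, normSq_eq_conj_mul_self, hconja, hconjb, hQC]
      simp only [a', b']
      linear_combination (conj (a x) * a x - conj (b x) * b x) * hRC x
    exact_mod_cast this
  have e2 : ∀ x, conj (a' x) * b' x = Q x * d' x := fun x => by
    rw [hconja, hQC]
    simp only [b']
    linear_combination (conj (a x) * b x) * hRC x
  have e3 : ∀ x, (normSq (a' x) + normSq (b' x)) = 2 * Q x * R x := fun x => by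
    have : (((normSq (a' x) + normSq (b' x) : ℝ)) : ℂ) = ((2 * Q x * R x : ℝ) : ℂ) := by
      push_cast
      rw [normSq_eq_conj_mul_self, normSq_eq_conj_mul_self, hconja, hconjb, hQC]
      simp only [a', b']
      linear_combination (-(conj (a x) * a x + conj (b x) * b x)) * hRC x
    exact_mod_cast this
  have hRpos : ∀ x, 0 < R x := fun x => by
    refine Real.sqrt_pos.2 (lt_of_le_of_ne (add_nonneg (sq_nonneg _) (normSq_nonneg _)) ?_)
    intro hz
    have h1 : c' x ^ 2 = 0 := by linarith [sq_nonneg (c' x), normSq_nonneg (d' x)]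
    have h2 : normSq (d' x) = 0 := by linarith [sq_nonneg (c' x), normSq_nonneg (d' x)]
    have h3 := hdot x
    rw [pow_eq_zero_iff two_ne_zero |>.1 h1, normSq_eq_zero.1 h2] at h3
    simp at h3
  have hR_eq : ∀ x y, c' x = c' y → d' x = d' y → R x = R y := fun x y h1 h2 => by
    simp only [R, h1, h2]
  have hdc := continuous_conj.comp hd'
  refine ⟨a', b', fun x => 1 / (2 * Q x), κ, l, ?_, ?_, hκ, fun x hx hx' => ?_, fun x => ?_,
    fun x => ?_, fun x => ?_, fun s σ => ?_, fun s σ => ?_⟩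
  · simp only [a']
    have : Continuous fun x => conj (d' x) := hdc
    fun_prop
  · simp only [b']; fun_prop
  · have := e3 x
    rw [hx, hx'] at this
    have h1 := mul_pos (hQ x) (hRpos x)
    simp at this
    rcases this with h | h
    · exact (hQ x).ne' h
    · exact (hRpos x).ne' h
  · have := hQ x; positivity
  · have := hQ x
    rw [e1]; field_simp
  · have : (Q x : ℂ) ≠ 0 := by exact_mod_cast (hQ x).ne'
    rw [e2]; push_cast; field_simp
  · have hR' := hR_eq _ _ (hcs s σ) (hds s σ)
    simp only [a', b', hcs, hds, (hs s σ).1, (hs s σ).2, hR', and_self]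
  · have hR' := hR_eq _ _ (hcσ s σ) (hdσ s σ)
    simp only [a', b', hcσ, hdσ, (hσ s σ).1, (hσ s σ).2, hR']
    exact ⟨by ring, by ring⟩

theorem exists_mem_square_of_periodic {α : Type*} (f : ℝ × ℝ → α)
    (hs : ∀ s σ, f (s + 2 * Real.pi, σ) = f (s, σ))
    (hσ : ∀ s σ, f (s, σ + 2 * Real.pi) = f (s, σ)) (x : ℝ × ℝ) :
    ∃ y ∈ Set.Icc 0 (2 * Real.pi) ×ˢ Set.Icc 0 (2 * Real.pi), f x = f y := by
  have h2 : (0 : ℝ) < 2 * Real.pi := by positivity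
  have p1 : Function.Periodic (fun s => f (s, x.2)) (2 * Real.pi) := fun s => hs s _
  obtain ⟨s, hs0, e1⟩ := p1.exists_mem_Ico₀ h2 x.1
  have p2 : Function.Periodic (fun σ => f (s, σ)) (2 * Real.pi) := fun σ => hσ s σ
  obtain ⟨σ, hσ0, e2⟩ := p2.exists_mem_Ico₀ h2 x.2
  exact ⟨(s, σ), ⟨Set.Ico_subset_Icc_self hs0, Set.Ico_subset_Icc_self hσ0⟩, e1.trans e2⟩

theorem HasDegree.homotopy {C : ℝ × ℝ × ℝ → ℝ} {D : ℝ × ℝ × ℝ → ℂ} (hC : Continuous C)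
    (hD : Continuous D)
    (hCs : ∀ τ s σ, C (τ, s + 2 * Real.pi, σ) = C (τ, s, σ))
    (hDs : ∀ τ s σ, D (τ, s + 2 * Real.pi, σ) = D (τ, s, σ))
    (hCσ : ∀ τ s σ, C (τ, s, σ + 2 * Real.pi) = C (τ, s, σ))
    (hDσ : ∀ τ s σ, D (τ, s, σ + 2 * Real.pi) = D (τ, s, σ))
    (h0 : ∀ x, C x = 0 → D x ≠ 0) {n : ℤ} {τ₀ : ℝ} (τ₁ : ℝ)
    (h : HasDegree (fun x => C (τ₀, x)) (fun x => D (τ₀, x)) n) :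
    HasDegree (fun x => C (τ₁, x)) (fun x => D (τ₁, x)) n := by
  have hCc : ∀ τ, Continuous fun x : ℝ × ℝ => C (τ, x) := fun τ => by fun_prop
  have hDc : ∀ τ, Continuous fun x : ℝ × ℝ => D (τ, x) := fun τ => by fun_prop
  have key : ∀ τ : ℝ, ∀ᶠ τ' in 𝓝 τ, ∀ x : ℝ × ℝ,
      0 < C (τ, x) * C (τ', x) + (conj (D (τ, x)) * D (τ', x)).re := by
    intro τ
    have hK : IsCompact (Set.Icc 0 (2 * Real.pi) ×ˢ Set.Icc (0 : ℝ) (2 * Real.pi)) :=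
      isCompact_Icc.prod isCompact_Icc
    have hf : Continuous fun z : ℝ × ℝ × ℝ =>
        C (τ, z.2) * C z + (conj (D (τ, z.2)) * D z).re := by
      have h1 : Continuous fun z : ℝ × ℝ × ℝ => D (τ, z.2) := (hDc τ).comp continuous_snd
      have h2 : Continuous fun z : ℝ × ℝ × ℝ => C (τ, z.2) := (hCc τ).comp continuous_snd
      exact (h2.mul hC).add (continuous_re.comp ((continuous_conj.comp h1).mul hD))
    have := hK.eventually_forall_of_forall_eventually (x₀ := τ)
      (P := fun τ' x => 0 < C (τ, x) * C (τ', x) + (conj (D (τ, x)) * D (τ', x)).re)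
      (fun x _ => by
        refine hf.continuousAt.eventually_const_lt ?_
        show 0 < C (τ, x) * C (τ, x) + (conj (D (τ, x)) * D (τ, x)).re
        rw [← normSq_eq_conj_mul_self, ofReal_re]
        by_cases h : C (τ, x) = 0
        · have := normSq_pos.2 (h0 _ h)
          rw [h]; linarith
        · have := mul_self_pos.2 h
          linarith [normSq_nonneg (D (τ, x))])
    filter_upwards [this] with τ' h' x
    obtain ⟨y, hy, e⟩ := exists_mem_square_of_periodic
      (fun x : ℝ × ℝ => 0 < C (τ, x) * C (τ', x) + (conj (D (τ, x)) * D (τ', x)).re)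
      (fun s σ => by simp only [hCs, hDs]) (fun s σ => by simp only [hCσ, hDσ]) x
    exact e.mpr (h' y hy)
  let S : Set ℝ := {τ | HasDegree (fun x => C (τ, x)) (fun x => D (τ, x)) n}
  have fwd : ∀ τ τ', (∀ x : ℝ × ℝ, 0 < C (τ, x) * C (τ', x) + (conj (D (τ, x)) * D (τ', x)).re) →
      τ ∈ S → τ' ∈ S := fun τ τ' hd hτ =>
    HasDegree.of_dot_pos hτ (hCc τ') (hDc τ') (hCs τ') (hDs τ') (hCσ τ') (hDσ τ') hd
  have hclopen : IsClopen S := by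
    constructor
    · rw [← isOpen_compl_iff, isOpen_iff_mem_nhds]
      intro τ hτ
      filter_upwards [key τ] with τ' h' hτ'
      refine hτ (fwd τ' τ (fun x => ?_) hτ')
      have := h' x
      simp only [mul_re, conj_re, conj_im] at this ⊢
      linarith
    · rw [isOpen_iff_mem_nhds]
      intro τ hτ
      filter_upwards [key τ] with τ' h'
      exact fwd τ τ' h' hτ
  have : S = Set.univ := hclopen.eq_univ ⟨τ₀, h⟩
  have h1 : τ₁ ∈ S := by rw [this]; trivial
  exact h1

/-- A complex function of modulus `|sin (θ / 2)|` whose argument jumps by `φ` each time `θ`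
passes a multiple of `2π`. -/
noncomputable def jumpPhase (θ φ : ℝ) : ℂ :=
  (|Real.sin (θ / 2)| : ℝ) * exp (I * φ * ⌊θ / (2 * Real.pi)⌋)

theorem norm_jumpPhase (θ φ : ℝ) : ‖jumpPhase θ φ‖ = |Real.sin (θ / 2)| := by
  have : I * φ * ⌊θ / (2 * Real.pi)⌋ = ((φ * ⌊θ / (2 * Real.pi)⌋ : ℝ) : ℂ) * I := by
    push_cast; ring
  rw [jumpPhase, this, norm_mul, norm_exp_ofReal_mul_I, norm_real, Real.norm_eq_abs, abs_abs,
    mul_one]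

theorem normSq_jumpPhase (θ φ : ℝ) : normSq (jumpPhase θ φ) = Real.sin (θ / 2) ^ 2 := by
  rw [normSq_eq_norm_sq, norm_jumpPhase, sq_abs]

theorem continuous_jumpPhase : Continuous fun x : ℝ × ℝ => jumpPhase x.1 x.2 := by
  rw [continuous_iff_continuousAt]
  rintro ⟨θ, φ⟩
  by_cases h : Real.sin (θ / 2) = 0
  · have h0 : jumpPhase θ φ = 0 := by rw [← norm_eq_zero, norm_jumpPhase, h, abs_zero]
    rw [ContinuousAt]
    dsimp only
    rw [h0, tendsto_zero_iff_norm_tendsto_zero]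
    simp only [norm_jumpPhase]
    have : Continuous fun x : ℝ × ℝ => |Real.sin (x.1 / 2)| := by fun_prop
    simpa [h] using this.tendsto (θ, φ)
  · have hne : (⌊θ / (2 * Real.pi)⌋ : ℝ) < θ / (2 * Real.pi) := by
      refine lt_of_le_of_ne (Int.floor_le _) fun he => h ?_
      rw [Real.sin_eq_zero_iff]
      refine ⟨⌊θ / (2 * Real.pi)⌋, ?_⟩
      rw [he]
      field_simp
    have hc : ContinuousAt (fun x : ℝ × ℝ => x.1 / (2 * Real.pi)) (θ, φ) := by fun_prop
    have hev := (hc.eventually (lt_mem_nhds hne)).and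
      (hc.eventually (gt_mem_nhds (Int.lt_floor_add_one (θ / (2 * Real.pi)))))
    have hg : ContinuousAt (fun x : ℝ × ℝ => ((|Real.sin (x.1 / 2)| : ℝ) : ℂ) *
        exp (I * x.2 * ⌊θ / (2 * Real.pi)⌋)) (θ, φ) := by fun_prop
    refine hg.congr ?_
    filter_upwards [hev] with x hx
    rw [jumpPhase, Int.floor_eq_iff.2 ⟨hx.1.le, hx.2⟩]

theorem jumpPhase_comp_continuous {X : Type*} [TopologicalSpace X] {θ φ : X → ℝ}
    (hθ : Continuous θ) (hφ : Continuous φ) : Continuous fun x => jumpPhase (θ x) (φ x) := by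
  have := continuous_jumpPhase.comp (hθ.prodMk hφ)
  simpa only [Function.comp_def] using this

theorem jumpPhase_mul (θ φ : ℝ) : 2 * (conj (jumpPhase (θ + Real.pi) φ) * jumpPhase θ φ) =
    (max (Real.sin θ) 0 : ℝ) + (max (-Real.sin θ) 0 : ℝ) * exp (-(I * φ)) := by
  have hpi := Real.pi_pos
  set m := ⌊θ / (2 * Real.pi)⌋ with hm
  have h1 : (m : ℝ) * (2 * Real.pi) ≤ θ := by
    have := Int.floor_le (θ / (2 * Real.pi))
    rwa [le_div_iff₀ (by positivity)] at this
  have h2 : θ < (m + 1 : ℝ) * (2 * Real.pi) := by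
    have := Int.lt_floor_add_one (θ / (2 * Real.pi))
    rwa [div_lt_iff₀ (by positivity)] at this
  have hsin : Real.sin (θ - m * (2 * Real.pi)) = Real.sin θ := Real.sin_sub_int_mul_two_pi _ _
  have hprod : 2 * (|Real.sin ((θ + Real.pi) / 2)| * |Real.sin (θ / 2)|) = |Real.sin θ| := by
    have e1 : Real.sin ((θ + Real.pi) / 2) = Real.cos (θ / 2) := by
      rw [add_div, Real.sin_add_pi_div_two]
    have e2 : Real.sin θ = 2 * Real.sin (θ / 2) * Real.cos (θ / 2) := by
      rw [← Real.sin_two_mul]; congr 1; ring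
    rw [e1, e2, abs_mul, abs_mul, abs_two]; ring
  have hconj : ∀ k : ℤ, conj (exp (I * φ * k)) = exp (-(I * φ * k)) := fun k => by
    rw [← exp_conj]; simp
  have hgen : ∀ k : ℤ, ⌊(θ + Real.pi) / (2 * Real.pi)⌋ = k →
      2 * (conj (jumpPhase (θ + Real.pi) φ) * jumpPhase θ φ) =
        (|Real.sin θ| : ℝ) * exp (I * φ * (m - k)) := fun k hk => by
    rw [jumpPhase, jumpPhase, hk, ← hm, map_mul, conj_ofReal, hconj, ← hprod, mul_sub, sub_eq_add_neg,
      exp_add]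
    push_cast; ring
  rcases lt_or_ge θ (m * (2 * Real.pi) + Real.pi) with h | h
  · have hs : 0 ≤ Real.sin θ := by
      rw [← hsin]
      exact Real.sin_nonneg_of_nonneg_of_le_pi (by linarith) (by linarith)
    rw [hgen m (by rw [Int.floor_eq_iff, le_div_iff₀ (by positivity), div_lt_iff₀ (by positivity)];
                   constructor <;> linarith), abs_of_nonneg hs, max_eq_left hs,
      max_eq_right (by linarith)]
    simp
  · have hs : Real.sin θ ≤ 0 := by
      rw [← hsin, ← Real.sin_sub_two_pi]
      exact Real.sin_nonpos_of_nonpos_of_neg_pi_le (by linarith) (by linarith)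
    rw [hgen (m + 1) (by
        rw [Int.floor_eq_iff, le_div_iff₀ (by positivity), div_lt_iff₀ (by positivity)]
        push_cast
        constructor <;> linarith), abs_of_nonpos hs, max_eq_right hs,
      max_eq_left (by linarith)]
    push_cast
    rw [zero_add]
    congr 2
    ring

theorem exp_two_pi_int (k : ℤ) : exp (I * (2 * Real.pi * k)) = 1 :=
  exp_eq_one_iff.2 ⟨k, by ring⟩

theorem jumpPhase_add (θ φ : ℝ) (k j : ℤ) :
    jumpPhase (θ + k * (2 * Real.pi)) (φ + j * (2 * Real.pi)) =
      exp (I * φ * k) * jumpPhase θ φ := by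
  have hpi := Real.pi_pos
  have h1 : (θ + k * (2 * Real.pi)) / (2 * Real.pi) = θ / (2 * Real.pi) + k := by
    field_simp
  have h2 : |Real.sin ((θ + k * (2 * Real.pi)) / 2)| = |Real.sin (θ / 2)| := by
    rw [show (θ + k * (2 * Real.pi)) / 2 = θ / 2 + k * Real.pi by ring]
    rw [Real.sin_add_int_mul_pi, abs_mul, abs_zpow, abs_neg, abs_one, one_zpow, one_mul]
  rw [jumpPhase, jumpPhase, h1, h2, Int.floor_add_intCast]
  have h3 : I * ((φ + j * (2 * Real.pi) : ℝ) : ℂ) * ((⌊θ / (2 * Real.pi)⌋ + k : ℤ) : ℂ) =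
      I * φ * k + I * φ * ⌊θ / (2 * Real.pi)⌋ +
        I * (2 * Real.pi * ((j * (⌊θ / (2 * Real.pi)⌋ + k) : ℤ) : ℂ)) := by
    push_cast; ring
  rw [h3, exp_add, exp_two_pi_int, exp_add]
  ring

theorem hasDegree_cable_model (δ : ℤ) : HasDegree (fun x => -Real.sin (3 * δ * x.2))
    (fun x => (max (Real.cos (3 * δ * x.2)) 0 : ℝ) * exp (-(2 * I * δ * x.2)) -
      (max (-Real.cos (3 * δ * x.2)) 0 : ℝ) * exp (-(2 * I * δ * x.1))) (6 * δ ^ 2) := by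
  obtain ⟨θ, hθ⟩ : ∃ θ : ℝ × ℝ → ℝ, ∀ x, θ x = 3 * δ * x.2 + Real.pi / 2 := ⟨_, fun _ => rfl⟩
  obtain ⟨φ, hφ⟩ : ∃ φ : ℝ × ℝ → ℝ, ∀ x, φ x = 2 * δ * (x.1 - x.2) + Real.pi := ⟨_, fun _ => rfl⟩
  have hθc : Continuous θ := by rw [funext hθ]; fun_prop
  have hφc : Continuous φ := by rw [funext hφ]; fun_prop
  have hpi2 : ∀ a, Real.sin ((a + Real.pi) / 2) = Real.cos (a / 2) := fun a => by
    rw [add_div, Real.sin_add_pi_div_two]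
  have hns : ∀ x : ℝ, normSq (exp (-(2 * I * δ * x))) = 1 := fun x => by
    rw [normSq_eq_norm_sq, show -(2 * I * δ * x) = ((-(2 * δ * x) : ℝ) : ℂ) * I by push_cast; ring,
      norm_exp_ofReal_mul_I, one_pow]
  refine ⟨fun x => jumpPhase (θ x + Real.pi) (φ x),
    fun x => jumpPhase (θ x) (φ x) * exp (-(2 * I * δ * x.2)), fun _ => 1,
    exp (I * (3 * δ * Real.pi)), -(6 * δ ^ 2), ?_, ?_, exp_ne_zero _, fun x hx hx' => ?_,
    fun _ => one_pos, fun x => ?_, fun x => ?_, fun s σ => ?_, fun s σ => ?_⟩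
  · exact jumpPhase_comp_continuous (hθc.add continuous_const) hφc
  · have h2 : Continuous fun x : ℝ × ℝ => exp (-(2 * I * δ * x.2)) := by fun_prop
    exact (jumpPhase_comp_continuous hθc hφc).mul h2
  · have h1 := congrArg norm hx
    rw [norm_jumpPhase, hpi2, norm_zero, abs_eq_zero] at h1
    have h2 := congrArg norm ((mul_eq_zero.1 hx').resolve_right (exp_ne_zero _))
    rw [norm_jumpPhase, norm_zero, abs_eq_zero] at h2
    have := Real.sin_sq_add_cos_sq (θ x / 2)
    rw [h1, h2] at this
    norm_num at this
  · beta_reduce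
    rw [normSq_mul, hns, normSq_jumpPhase, normSq_jumpPhase, hpi2]
    have h1 : Real.cos (θ x) = -Real.sin (3 * δ * x.2) := by
      rw [hθ]; exact Real.cos_add_pi_div_two _
    have h2 : Real.cos (θ x) = 2 * Real.cos (θ x / 2) ^ 2 - 1 := by
      rw [← Real.cos_two_mul]; congr 1; ring
    have := Real.sin_sq_add_cos_sq (θ x / 2)
    linarith
  · beta_reduce
    rw [← mul_assoc (conj _), ← mul_assoc (2 : ℂ), jumpPhase_mul]
    have h1 : Real.sin (θ x) = Real.cos (3 * δ * x.2) := by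
      rw [hθ]; exact Real.sin_add_pi_div_two _
    have h2 : exp (-(I * φ x)) * exp (-(2 * I * δ * x.2)) = -exp (-(2 * I * δ * x.1)) := by
      rw [← exp_add, ← neg_one_mul (exp _), ← exp_pi_mul_I, ← exp_add, exp_eq_exp_iff_exists_int]
      refine ⟨-1, ?_⟩
      simp only [hφ]
      push_cast; ring
    rw [h1, add_mul, mul_assoc ((max (-_) _ : ℝ) : ℂ), h2]
    push_cast; ring
  · have h1 : φ (s + 2 * Real.pi, σ) = φ (s, σ) + (2 * δ : ℤ) * (2 * Real.pi) := by
      simp only [hφ]; push_cast; ring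
    have := fun a b => jumpPhase_add a b 0 (2 * δ)
    simp only [Int.cast_zero, zero_mul, add_zero, mul_zero, exp_zero, one_mul] at this
    have h2 : θ (s + 2 * Real.pi, σ) = θ (s, σ) := by simp only [hθ]
    beta_reduce
    rw [h1, h2, this, this]
    exact ⟨rfl, rfl⟩
  · have h1 : φ (s, σ + 2 * Real.pi) = φ (s, σ) + (-2 * δ : ℤ) * (2 * Real.pi) := by
      simp only [hφ]; push_cast; ring
    have h2 : θ (s, σ + 2 * Real.pi) = θ (s, σ) + (3 * δ : ℤ) * (2 * Real.pi) := by
      simp only [hθ]; push_cast; ring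
    have h3 : exp (I * (φ (s, σ)) * (3 * δ : ℤ)) = exp (I * (3 * δ * Real.pi)) *
        exp (I * ((6 * δ ^ 2 : ℤ) * s + (-(6 * δ ^ 2) : ℤ) * σ)) := by
      rw [← exp_add]
      congr 1
      simp only [hφ]; push_cast; ring
    have h4 : exp (-(2 * I * δ * (σ + 2 * Real.pi : ℝ))) = exp (-(2 * I * δ * σ)) := by
      rw [show -(2 * I * δ * (σ + 2 * Real.pi : ℝ)) =
        -(2 * I * δ * σ) + I * (2 * Real.pi * (-2 * δ : ℤ)) by push_cast; ring, exp_add,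
        exp_two_pi_int, mul_one]
    beta_reduce
    dsimp only
    rw [h1, h2, jumpPhase_add, add_right_comm, jumpPhase_add, h3, h4]
    exact ⟨rfl, by ring⟩

/-- The three-sphere `‖A‖³ + ‖B‖² = 2` in `ℂ²`, invariant under the action of the circle for
which the trefoil `A³ = B²` is an orbit. -/
abbrev LinkSphere := {q : ℂ × ℂ // ‖q.1‖ ^ 3 + ‖q.2‖ ^ 2 = 2}

instance : CompactSpace LinkSphere := by
  refine isCompact_iff_compactSpace.1 (Metric.isCompact_of_isClosed_isBounded ?_ ?_)
  · exact isClosed_eq (by fun_prop) continuous_const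
  · refine (Metric.isBounded_closedBall (x := (0 : ℂ × ℂ)) (r := 2)).subset ?_
    rintro ⟨A, B⟩ h
    have h' : ‖A‖ ^ 3 + ‖B‖ ^ 2 = 2 := h
    rw [mem_closedBall_zero_iff]
    refine max_le ?_ ?_
    · have h1 : ‖A‖ ^ 3 ≤ 2 ^ 3 := by nlinarith [sq_nonneg ‖B‖]
      exact le_of_pow_le_pow_left₀ three_ne_zero zero_le_two h1
    · have h1 : ‖B‖ ^ 2 ≤ 2 ^ 2 := by nlinarith [pow_nonneg (norm_nonneg A) 3]
      exact le_of_pow_le_pow_left₀ two_ne_zero zero_le_two h1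

/-- The point of `LinkSphere` sent to infinity. -/
noncomputable def LinkSphere.pole : LinkSphere := ⟨(0, (√2 : ℝ)), by simp⟩

noncomputable def chartDen (b : ℂ) : ℂ := b * (normSq b - 1) - (normSq b + 2)

noncomputable def chartNum (b : ℂ) : ℂ := b * (1 + 2 * normSq b) + normSq b - 1

noncomputable def chartRatio (q : ℂ × ℂ) : ℂ := chartNum (q.2 * ‖q.2‖) / chartDen (q.2 * ‖q.2‖)

noncomputable def chartAux (q : ℂ × ℂ) : ℂ :=
  conj q.1 * (√‖q.1‖ : ℝ) * (√((2 + ‖q.2‖ ^ 2) / 3) : ℝ)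

noncomputable def chartPlane (q : ℂ × ℂ) : ℂ := (chartRatio q - 2) * chartAux q

/-- A chart of the complement of the pole of `LinkSphere` with values in `ℝ³`. -/
noncomputable def chart (q : ℂ × ℂ) : Fin 3 → ℝ :=
  ![(chartPlane q).im, (chartPlane q).re, -(chartRatio q).im]

theorem normSq_chartAux (q : ℂ × ℂ) : normSq (chartAux q) = ‖q.1‖ ^ 3 * ((2 + ‖q.2‖ ^ 2) / 3) := by
  rw [chartAux, normSq_mul, normSq_mul, normSq_conj, normSq_ofReal, normSq_ofReal,
    Real.mul_self_sqrt (norm_nonneg _), Real.mul_self_sqrt (by positivity), normSq_eq_norm_sq]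
  ring

theorem normSq_mul_norm (B : ℂ) : normSq (B * ‖B‖) = (‖B‖ ^ 2) ^ 2 := by
  rw [normSq_mul, normSq_ofReal, normSq_eq_norm_sq]; ring

theorem three_mul_normSq_chartAux {q : ℂ × ℂ} (h : ‖q.1‖ ^ 3 + ‖q.2‖ ^ 2 = 2) :
    3 * normSq (chartAux q) + normSq (q.2 * ‖q.2‖) = 4 := by
  rw [normSq_chartAux, normSq_mul_norm, eq_sub_of_add_eq h]; ring

theorem eq_two_of_chartDen_eq_zero {b : ℂ} (h : chartDen b = 0) : b = 2 := by
  have h1 : b * (normSq b - 1) = normSq b + 2 := sub_eq_zero.1 h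
  have h2 : ‖b‖ * |‖b‖ ^ 2 - 1| = ‖b‖ ^ 2 + 2 := by
    have := congrArg norm h1
    rw [norm_mul, normSq_eq_norm_sq, ← ofReal_one, ← ofReal_sub, norm_real, Real.norm_eq_abs,
      show (((‖b‖ ^ 2 : ℝ) : ℂ) + 2) = ((‖b‖ ^ 2 + 2 : ℝ) : ℂ) by push_cast; rfl, norm_real,
      Real.norm_eq_abs, abs_of_nonneg (by positivity : 0 ≤ ‖b‖ ^ 2 + 2)] at this
    exact this
  have h3 : ‖b‖ = 2 := by
    have hn := norm_nonneg b
    rcases abs_cases (‖b‖ ^ 2 - 1) with ⟨e, _⟩ | ⟨e, _⟩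
    · rw [e] at h2
      have : (‖b‖ - 2) * (‖b‖ ^ 2 + ‖b‖ + 1) = 0 := by linear_combination h2
      exact sub_eq_zero.1 ((mul_eq_zero.1 this).resolve_right (by positivity))
    · rw [e] at h2
      nlinarith
  rw [normSq_eq_norm_sq, h3] at h1
  push_cast at h1
  linear_combination h1 / 3

theorem eq_of_mul_norm_eq {B B' : ℂ} (h : B * ‖B‖ = B' * ‖B'‖) : B = B' := by
  have h1 : ‖B‖ = ‖B'‖ := by
    have := congrArg norm h
    rw [norm_mul, norm_mul, norm_real, norm_real, norm_norm, norm_norm, ← sq, ← sq] at this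
    exact (pow_left_inj₀ (norm_nonneg _) (norm_nonneg _) two_ne_zero).1 this
  by_cases h0 : B' = 0
  · rw [h0, norm_zero, norm_eq_zero] at h1; rw [h1, h0]
  · rw [h1] at h
    exact mul_right_cancel₀ (by simpa using h0) h

theorem exists_mul_norm_eq (b : ℂ) : ∃ B : ℂ, B * ‖B‖ = b := by
  by_cases h : b = 0
  · exact ⟨0, by simp [h]⟩
  · have hb := norm_pos_iff.2 h
    refine ⟨b / (√‖b‖ : ℝ), ?_⟩
    rw [norm_div, norm_real, Real.norm_eq_abs, abs_of_nonneg (Real.sqrt_nonneg _), Real.div_sqrt]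
    have : ((√‖b‖ : ℝ) : ℂ) ≠ 0 := by exact_mod_cast (Real.sqrt_pos.2 hb).ne'
    field_simp

theorem eq_of_mul_sqrt_norm_eq {A A' : ℂ} (h : conj A * (√‖A‖ : ℝ) = conj A' * (√‖A'‖ : ℝ)) :
    A = A' := by
  have h1 : ‖A‖ = ‖A'‖ := by
    have := congrArg normSq h
    rw [normSq_mul, normSq_mul, normSq_conj, normSq_conj, normSq_ofReal, normSq_ofReal,
      Real.mul_self_sqrt (norm_nonneg _), Real.mul_self_sqrt (norm_nonneg _), normSq_eq_norm_sq,
      normSq_eq_norm_sq, ← pow_succ, ← pow_succ] at this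
    exact (pow_left_inj₀ (norm_nonneg _) (norm_nonneg _) three_ne_zero).1 this
  by_cases h0 : A' = 0
  · rw [h0, norm_zero, norm_eq_zero] at h1; rw [h1, h0]
  · rw [h1] at h
    have : ((√‖A'‖ : ℝ) : ℂ) ≠ 0 := by
      exact_mod_cast (Real.sqrt_pos.2 (norm_pos_iff.2 h0)).ne'
    exact (starRingEnd ℂ).injective (mul_right_cancel₀ this h)

theorem exists_mul_sqrt_norm_eq (a : ℂ) : ∃ A : ℂ, conj A * (√‖A‖ : ℝ) = a := by
  by_cases h : a = 0
  · exact ⟨0, by simp [h]⟩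
  · have ha := norm_pos_iff.2 h
    obtain ⟨r, hr, hra⟩ : ∃ r : ℝ, 0 < r ∧ r ^ 3 = ‖a‖ :=
      ⟨‖a‖ ^ (1 / 3 : ℝ), by positivity, by rw [← Real.rpow_natCast, ← Real.rpow_mul ha.le]; norm_num⟩
    refine ⟨conj a / r, ?_⟩
    have e : ‖conj a / r‖ = r ^ 2 := by
      rw [norm_div, norm_conj, norm_real, Real.norm_eq_abs, abs_of_pos hr, ← hra]
      field_simp
    rw [e, Real.sqrt_sq hr.le]
    have : (r : ℂ) ≠ 0 := by exact_mod_cast hr.ne'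
    simp only [map_div₀, conj_conj, conj_ofReal]
    field_simp

theorem chartDen_ne_zero {x : LinkSphere} (hx : x ≠ LinkSphere.pole) :
    chartDen (x.1.2 * ‖x.1.2‖) ≠ 0 := fun h => hx <| by
  have h1 := eq_two_of_chartDen_eq_zero h
  have h2 := three_mul_normSq_chartAux x.2
  have h3 : x.1.2 = (√2 : ℝ) := by
    refine eq_of_mul_norm_eq ?_
    rw [h1, norm_real, Real.norm_eq_abs, abs_of_nonneg (Real.sqrt_nonneg _), ← ofReal_mul,
      Real.mul_self_sqrt zero_le_two]
    rfl
  have h4 := x.2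
  rw [h3, norm_real, Real.norm_eq_abs, sq_abs, Real.sq_sqrt zero_le_two] at h4
  have h5 : x.1.1 = 0 := norm_eq_zero.1 (pow_eq_zero_iff three_ne_zero |>.1 (by linarith))
  exact Subtype.ext (Prod.ext h5 h3)

theorem chartRatio_sub_two {q : ℂ × ℂ} (h : chartDen (q.2 * ‖q.2‖) ≠ 0) :
    chartRatio q - 2 =
      3 * (1 + normSq (q.2 * ‖q.2‖) + q.2 * ‖q.2‖) / chartDen (q.2 * ‖q.2‖) := by
  rw [chartRatio, div_sub' h]
  congr 1
  rw [chartNum, chartDen]; ring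

theorem one_add_normSq_add_ne_zero (b : ℂ) : 1 + (normSq b : ℂ) + b ≠ 0 := fun h => by
  have h1 := congrArg re h
  have h2 := congrArg im h
  simp [normSq_apply] at h1 h2
  nlinarith [sq_nonneg (b.re + 1 / 2)]

theorem normSq_chartPlane {q : ℂ × ℂ} (hq : ‖q.1‖ ^ 3 + ‖q.2‖ ^ 2 = 2)
    (h : chartDen (q.2 * ‖q.2‖) ≠ 0) :
    normSq (chartPlane q) = 5 - 4 * (chartRatio q).re := by
  have h1 := three_mul_normSq_chartAux hq
  rw [chartPlane, normSq_mul, chartRatio_sub_two h, normSq_div, chartRatio, div_re]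
  generalize q.2 * ‖q.2‖ = b at *
  have hd : normSq (chartDen b) ≠ 0 := fun h0 => h (normSq_eq_zero.1 h0)
  rw [show normSq (chartAux q) = (4 - normSq b) / 3 by linarith]
  field_simp
  simp only [chartNum, chartDen, normSq_apply]
  simp
  ring

theorem chart_injective {x y : LinkSphere} (hx : x ≠ LinkSphere.pole) (hy : y ≠ LinkSphere.pole)
    (h : chart x.1 = chart y.1) : x = y := by
  have dx := chartDen_ne_zero hx
  have dy := chartDen_ne_zero hy
  have hw : chartPlane x.1 = chartPlane y.1 :=
    Complex.ext (congrFun h 1) (congrFun h 0)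
  have hu : chartRatio x.1 = chartRatio y.1 := by
    refine Complex.ext ?_ (neg_injective (congrFun h 2))
    have e1 := normSq_chartPlane x.2 dx
    have e2 := normSq_chartPlane y.2 dy
    rw [hw] at e1
    linarith
  have hu2 : chartRatio y.1 - 2 ≠ 0 := by
    rw [chartRatio_sub_two dy]
    exact div_ne_zero (mul_ne_zero three_ne_zero (one_add_normSq_add_ne_zero _)) dy
  have ha : chartAux x.1 = chartAux y.1 := by
    rw [chartPlane, chartPlane, hu] at hw
    exact mul_left_cancel₀ hu2 hw
  have hn : normSq (x.1.2 * ‖x.1.2‖) = normSq (y.1.2 * ‖y.1.2‖) := by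
    have e1 := three_mul_normSq_chartAux x.2
    have e2 := three_mul_normSq_chartAux y.2
    rw [ha] at e1
    linarith
  have hB : x.1.2 = y.1.2 := by
    refine eq_of_mul_norm_eq ?_
    rw [chartRatio, chartRatio, div_eq_div_iff dx dy] at hu
    simp only [chartNum, chartDen] at hu
    rw [hn] at hu
    have hn0 := normSq_nonneg (y.1.2 * ‖y.1.2‖)
    generalize normSq (y.1.2 * ‖y.1.2‖) = n at *
    have h0 : (3 * (n ^ 2 + n + 1) : ℂ) ≠ 0 := by
      have : (3 * (n ^ 2 + n + 1) : ℝ) ≠ 0 := by positivity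
      exact_mod_cast this
    refine mul_left_cancel₀ h0 ?_
    linear_combination -hu
  have hA : x.1.1 = y.1.1 := by
    refine eq_of_mul_sqrt_norm_eq ?_
    rw [chartAux, chartAux, hB] at ha
    refine mul_right_cancel₀ ?_ ha
    have : 0 < √((2 + ‖y.1.2‖ ^ 2) / 3) := Real.sqrt_pos.2 (by positivity)
    exact_mod_cast this.ne'
  exact Subtype.ext (Prod.ext hA hB)

theorem one_add_normSq_sub_ne_zero (b : ℂ) : 1 + (normSq b : ℂ) - b ≠ 0 := by
  simpa [sub_eq_add_neg] using one_add_normSq_add_ne_zero (-b)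

theorem exists_chart_eq (p : Fin 3 → ℝ) : ∃ x : LinkSphere, x ≠ LinkSphere.pole ∧ chart x.1 = p := by
  let w : ℂ := ⟨p 1, p 0⟩
  let u : ℂ := ⟨(5 - normSq w) / 4, -p 2⟩
  have hu2 : u - 2 ≠ 0 := fun h => by
    have := congrArg re h
    simp [u] at this
    linarith [normSq_nonneg w]
  obtain ⟨b, hb⟩ : ∃ b : ℂ, b = (2 * u - 1) / (u - 2) := ⟨_, rfl⟩
  obtain ⟨n, hn⟩ : ∃ n : ℝ, n = normSq b := ⟨_, rfl⟩
  have hbn : (1 + n : ℂ) - b ≠ 0 := hn ▸ one_add_normSq_sub_ne_zero b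
  obtain ⟨b₀, hb₀⟩ : ∃ b₀ : ℂ, b₀ = (b * (1 + n) - n) / (1 + n - b) := ⟨_, rfl⟩
  have hn₀ : normSq b₀ = n := by
    rw [hb₀, normSq_div, div_eq_iff (by rwa [Ne, normSq_eq_zero])]
    simp only [normSq_apply] at hn ⊢
    simp
    rw [hn]; ring
  obtain ⟨a, ha⟩ : ∃ a : ℂ, a = w / (u - 2) := ⟨_, rfl⟩
  have han : 3 * normSq a + n = 4 := by
    rw [ha, hn, hb, normSq_div, normSq_div]
    have : normSq (u - 2) ≠ 0 := by rwa [Ne, normSq_eq_zero]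
    field_simp
    have hw : normSq w = 5 - 4 * u.re := by simp only [u]; ring
    rw [hw]
    simp [normSq_apply]
    ring
  obtain ⟨B, hB⟩ := exists_mul_norm_eq b₀
  have hBn : (‖B‖ ^ 2) ^ 2 = n := by rw [← normSq_mul_norm, hB, hn₀]
  have hc : 0 < √((2 + ‖B‖ ^ 2) / 3) := Real.sqrt_pos.2 (by positivity)
  have hcC : ((√((2 + ‖B‖ ^ 2) / 3) : ℝ) : ℂ) ≠ 0 := by exact_mod_cast hc.ne'
  obtain ⟨A, hA⟩ := exists_mul_sqrt_norm_eq (a / (√((2 + ‖B‖ ^ 2) / 3) : ℝ))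
  have hAa : chartAux (A, B) = a := by
    rw [chartAux, hA]; field_simp
  have hS : ‖A‖ ^ 3 + ‖B‖ ^ 2 = 2 := by
    have := normSq_chartAux (A, B)
    rw [hAa] at this
    have h2 : (2 + ‖B‖ ^ 2) * (‖A‖ ^ 3 + ‖B‖ ^ 2 - 2) = 0 := by
      dsimp only at this
      linear_combination -3 * this + han + hBn
    exact sub_eq_zero.1 ((mul_eq_zero.1 h2).resolve_left (by positivity))
  have hkey : chartDen b₀ * u = chartNum b₀ := by
    rw [chartDen, chartNum, hn₀, hb₀]
    field_simp
    have : b * (u - 2) = 2 * u - 1 := by rw [hb]; field_simp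
    linear_combination (1 + n + n ^ 2 : ℂ) * this
  have hdet : chartDen b₀ ≠ 0 := fun h => by
    rw [h, zero_mul] at hkey
    have := eq_two_of_chartDen_eq_zero h
    rw [this, chartNum] at hkey
    norm_num [normSq_apply] at hkey
  have hratio : chartRatio (A, B) = u := by
    rw [chartRatio]; dsimp only
    rw [hB, ← hkey, mul_div_cancel_left₀ _ hdet]
  have hplane : chartPlane (A, B) = w := by
    rw [chartPlane, hratio, hAa, ha]; field_simp
  refine ⟨⟨(A, B), hS⟩, fun h => ?_, ?_⟩
  · have : B = (√2 : ℝ) := congrArg (fun x : LinkSphere => x.1.2) h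
    refine hdet ?_
    rw [← hB, this, norm_real, Real.norm_eq_abs, abs_of_nonneg (Real.sqrt_nonneg _), ← ofReal_mul,
      Real.mul_self_sqrt zero_le_two]
    norm_num [chartDen, normSq_apply]
  · ext i
    fin_cases i
    · simp [chart, hplane, w]
    · simp [chart, hplane, w]
    · simp [chart, hratio, u]

open Classical in
/-- The chart `chart`, extended by sending the pole to infinity. -/
noncomputable def chartMap (x : LinkSphere) : OnePoint (Fin 3 → ℝ) :=
  if x = LinkSphere.pole then OnePoint.infty else (chart x.1 : Fin 3 → ℝ)

theorem chartMap_pole : chartMap LinkSphere.pole = OnePoint.infty := if_pos rfl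

theorem chartMap_of_ne {x : LinkSphere} (h : x ≠ LinkSphere.pole) :
    chartMap x = (chart x.1 : Fin 3 → ℝ) := if_neg h

theorem continuousAt_chart {q : ℂ × ℂ} (h : chartDen (q.2 * ‖q.2‖) ≠ 0) :
    ContinuousAt chart q := by
  have hns : Continuous fun q : ℂ × ℂ => normSq (q.2 * ‖q.2‖) :=
    continuous_normSq.comp (by fun_prop)
  have hden : Continuous fun q : ℂ × ℂ => chartDen (q.2 * ‖q.2‖) := by
    simp only [chartDen]; fun_prop
  have hnum : Continuous fun q : ℂ × ℂ => chartNum (q.2 * ‖q.2‖) := by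
    simp only [chartNum]; fun_prop
  have hratio : ContinuousAt chartRatio q := hnum.continuousAt.div hden.continuousAt h
  have haux : Continuous chartAux := by
    have : Continuous fun q : ℂ × ℂ => conj q.1 := continuous_conj.comp continuous_fst
    have h2 : ∀ q : ℂ × ℂ, chartAux q =
      conj q.1 * (√‖q.1‖ : ℝ) * (√((2 + ‖q.2‖ ^ 2) / 3) : ℝ) := fun _ => rfl
    rw [funext h2]; fun_prop
  have hplane : ContinuousAt chartPlane q := (hratio.sub continuousAt_const).mul haux.continuousAt
  rw [continuousAt_pi]
  intro i
  fin_cases i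
  · exact continuous_im.continuousAt.comp hplane
  · exact continuous_re.continuousAt.comp hplane
  · exact (continuous_im.continuousAt.comp hratio).neg

theorem continuous_chartMap : Continuous chartMap := by
  rw [continuous_iff_continuousAt]
  intro x
  by_cases hx : x = LinkSphere.pole
  · subst hx
    rw [ContinuousAt, chartMap_pole, OnePoint.hasBasis_nhds_infty.tendsto_right_iff]
    rintro s ⟨_, hs⟩
    obtain ⟨R, hR⟩ := hs.isBounded.exists_norm_le
    have hns : Continuous fun x : LinkSphere => normSq (x.1.2 * ‖x.1.2‖) :=
      continuous_normSq.comp (by fun_prop)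
    have hden : Continuous fun x : LinkSphere => chartDen (x.1.2 * ‖x.1.2‖) := by
      simp only [chartDen]; fun_prop
    have hnum : Continuous fun x : LinkSphere => chartNum (x.1.2 * ‖x.1.2‖) := by
      simp only [chartNum]; fun_prop
    have hp : LinkSphere.pole.1.2 * ‖LinkSphere.pole.1.2‖ = 2 := by
      show ((√2 : ℝ) : ℂ) * ‖((√2 : ℝ) : ℂ)‖ = 2
      rw [norm_real, Real.norm_eq_abs, abs_of_nonneg (Real.sqrt_nonneg _), ← ofReal_mul,
        Real.mul_self_sqrt zero_le_two]
      rfl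
    have hev : ∀ᶠ x : LinkSphere in 𝓝 LinkSphere.pole, (R ^ 2 + 5 + 3 * R) *
        ‖chartDen (x.1.2 * ‖x.1.2‖)‖ < ‖chartNum (x.1.2 * ‖x.1.2‖)‖ := by
      refine ContinuousAt.eventually_lt ?_ ?_ ?_
      · exact (continuous_const.mul hden.norm).continuousAt
      · exact hnum.norm.continuousAt
      · rw [hp]
        norm_num [chartDen, chartNum, normSq_apply]
    filter_upwards [hev] with x hx
    by_cases hxp : x = LinkSphere.pole
    · rw [hxp, chartMap_pole]; exact Or.inr rfl
    · refine Or.inl ⟨chart x.1, fun hmem => ?_, (chartMap_of_ne hxp).symm⟩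
      have hd := chartDen_ne_zero hxp
      have hb := hR _ hmem
      have h0 := (norm_le_pi_norm (chart x.1) 0).trans hb
      have h1 := (norm_le_pi_norm (chart x.1) 1).trans hb
      have h2 := (norm_le_pi_norm (chart x.1) 2).trans hb
      simp only [chart, Real.norm_eq_abs] at h0 h1 h2
      have e0 : |(chartPlane x.1).im| ≤ R := h0
      have e1 : |(chartPlane x.1).re| ≤ R := h1
      have e2 : |(chartRatio x.1).im| ≤ R := by simpa using h2
      have hR0 : 0 ≤ R := (abs_nonneg _).trans e0
      have hw := normSq_chartPlane x.2 hd
      rw [normSq_apply] at hw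
      have s0 := sq_le_sq' (abs_le.1 e0).1 (abs_le.1 e0).2
      have s1 := sq_le_sq' (abs_le.1 e1).1 (abs_le.1 e1).2
      have e3 : |(chartRatio x.1).re| ≤ R ^ 2 + 5 := by
        rw [abs_le]; constructor <;> nlinarith
      have hr : ‖chartRatio x.1‖ ≤ R ^ 2 + 5 + 3 * R :=
        (norm_le_abs_re_add_abs_im _).trans (by linarith)
      have : ‖chartNum (x.1.2 * ‖x.1.2‖)‖ =
          ‖chartRatio x.1‖ * ‖chartDen (x.1.2 * ‖x.1.2‖)‖ := by
        rw [← norm_mul, chartRatio, div_mul_cancel₀ _ hd]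
      rw [this] at hx
      exact absurd hx (not_lt.2 (mul_le_mul_of_nonneg_right hr (norm_nonneg _)))
  · have h1 : ContinuousAt (OnePoint.some ∘ chart ∘ Subtype.val) x :=
      OnePoint.continuous_coe.continuousAt.comp
        ((continuousAt_chart (chartDen_ne_zero hx)).comp continuous_subtype_val.continuousAt)
    refine h1.congr ?_
    filter_upwards [isOpen_ne.mem_nhds hx] with y hy
    exact (chartMap_of_ne hy).symm

theorem bijective_chartMap : Function.Bijective chartMap := by
  constructor
  · intro x y h
    by_cases hx : x = LinkSphere.pole <;> by_cases hy : y = LinkSphere.pole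
    · rw [hx, hy]
    · rw [hx, chartMap_pole, chartMap_of_ne hy] at h
      exact absurd h (OnePoint.infty_ne_coe _)
    · rw [hy, chartMap_pole, chartMap_of_ne hx] at h
      exact absurd h (OnePoint.coe_ne_infty _)
    · rw [chartMap_of_ne hx, chartMap_of_ne hy] at h
      exact chart_injective hx hy (OnePoint.coe_injective h)
  · intro y
    induction y using OnePoint.rec with
    | infty => exact ⟨_, chartMap_pole⟩
    | coe p =>
      obtain ⟨x, hx, h⟩ := exists_chart_eq p
      exact ⟨x, by rw [chartMap_of_ne hx, h]⟩

/-- `LinkSphere` is the one point compactification of `ℝ³`. -/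
noncomputable def chartHomeo : LinkSphere ≃ₜ OnePoint (Fin 3 → ℝ) :=
  Continuous.homeoOfEquivCompactToT2 (f := Equiv.ofBijective chartMap bijective_chartMap)
    continuous_chartMap

theorem chartHomeo_apply (x : LinkSphere) : chartHomeo x = chartMap x := rfl

/-- The homeomorphism of `LinkSphere` fixing the pole induced by one of `ℝ³`. -/
noncomputable def sphereLift (h : (Fin 3 → ℝ) ≃ₜ (Fin 3 → ℝ)) : LinkSphere ≃ₜ LinkSphere :=
  (chartHomeo.trans h.onePointCongr).trans chartHomeo.symm

theorem sphereLift_pole (h : (Fin 3 → ℝ) ≃ₜ (Fin 3 → ℝ)) :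
    sphereLift h LinkSphere.pole = LinkSphere.pole := by
  rw [sphereLift, Homeomorph.trans_apply, Homeomorph.trans_apply, Homeomorph.symm_apply_eq,
    chartHomeo_apply, chartMap_pole]
  rfl

theorem sphereLift_ne_pole (h : (Fin 3 → ℝ) ≃ₜ (Fin 3 → ℝ)) {x : LinkSphere}
    (hx : x ≠ LinkSphere.pole) : sphereLift h x ≠ LinkSphere.pole := fun he =>
  hx ((sphereLift h).injective (he.trans (sphereLift_pole h).symm))

theorem chart_sphereLift (h : (Fin 3 → ℝ) ≃ₜ (Fin 3 → ℝ)) {x : LinkSphere}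
    (hx : x ≠ LinkSphere.pole) : chart (sphereLift h x).1 = h (chart x.1) := by
  refine OnePoint.coe_injective ?_
  rw [← chartMap_of_ne (sphereLift_ne_pole h hx), ← chartHomeo_apply, sphereLift,
    Homeomorph.trans_apply, Homeomorph.trans_apply, Homeomorph.apply_symm_apply, chartHomeo_apply,
    chartMap_of_ne hx]
  rfl

/-- The positive factor which moves `q` to `LinkSphere` under the weighted scaling. -/
noncomputable def sphereScale (q : ℂ × ℂ) : ℝ := (2 / (‖q.1‖ ^ 3 + ‖q.2‖ ^ 2)) ^ (1 / 6 : ℝ)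

theorem weight_pos {q : ℂ × ℂ} (hq : q ≠ 0) : 0 < ‖q.1‖ ^ 3 + ‖q.2‖ ^ 2 := by
  by_cases h : q.1 = 0
  · have h2 : q.2 ≠ 0 := fun h2 => hq (Prod.ext h h2)
    have := norm_pos_iff.2 h2
    positivity
  · have := norm_pos_iff.2 h
    positivity

theorem sphereScale_pos {q : ℂ × ℂ} (hq : q ≠ 0) : 0 < sphereScale q :=
  Real.rpow_pos_of_pos (div_pos two_pos (weight_pos hq)) _

theorem sphereScale_pow {q : ℂ × ℂ} (hq : q ≠ 0) :
    sphereScale q ^ 6 * (‖q.1‖ ^ 3 + ‖q.2‖ ^ 2) = 2 := by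
  have h := weight_pos hq
  rw [sphereScale, ← Real.rpow_natCast, ← Real.rpow_mul (div_pos two_pos h).le]
  norm_num
  field_simp

/-- The point of `LinkSphere` on the weighted ray through a nonzero `q`. -/
noncomputable def toSphere (q : ℂ × ℂ) (hq : q ≠ 0) : LinkSphere :=
  ⟨((sphereScale q : ℂ) ^ 2 * q.1, (sphereScale q : ℂ) ^ 3 * q.2), by
    have h1 := sphereScale_pow hq
    simp only [norm_mul, norm_pow, norm_real, Real.norm_eq_abs, abs_of_pos (sphereScale_pos hq)]
    linear_combination h1⟩

theorem Continuous.toSphere {X : Type*} [TopologicalSpace X] {f : X → ℂ × ℂ} (hf : Continuous f)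
    (h : ∀ x, f x ≠ 0) : Continuous fun x => toSphere (f x) (h x) := by
  have h1 : Continuous fun x => sphereScale (f x) := by
    simp only [sphereScale]
    refine Continuous.rpow_const (continuous_const.div (by fun_prop) fun x => ?_) (by norm_num)
    exact (weight_pos (h x)).ne'
  refine Continuous.subtype_mk ?_ _
  fun_prop

theorem toSphere_of_mem {x : LinkSphere} (h : x.1 ≠ 0) : toSphere x.1 h = x := by
  have : sphereScale x.1 = 1 := by rw [sphereScale, x.2]; norm_num
  refine Subtype.ext ?_
  simp [toSphere, this]

theorem toSphere_congr {q q' : ℂ × ℂ} (h : q = q') (hq : q ≠ 0) :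
    toSphere q hq = toSphere q' (h ▸ hq) := by subst h; rfl

/-- The trefoil in `LinkSphere`. -/
def knotSet : Set LinkSphere := {x | x.1.1 ^ 3 = x.1.2 ^ 2}

theorem toSphere_mem_knotSet {q : ℂ × ℂ} (hq : q ≠ 0) :
    toSphere q hq ∈ knotSet ↔ q.1 ^ 3 = q.2 ^ 2 := by
  have h : (sphereScale q : ℂ) ≠ 0 := by exact_mod_cast (sphereScale_pos hq).ne'
  show ((sphereScale q : ℂ) ^ 2 * q.1) ^ 3 = ((sphereScale q : ℂ) ^ 3 * q.2) ^ 2 ↔ _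
  rw [mul_pow, mul_pow, ← pow_mul, ← pow_mul]
  exact mul_right_inj' (pow_ne_zero 6 h)

theorem ne_pole_of_fst_ne_zero {x : LinkSphere} (h : x.1.1 ≠ 0) : x ≠ LinkSphere.pole :=
  fun he => h (by rw [he]; rfl)

theorem toSphere_ne_pole {q : ℂ × ℂ} (hq : q ≠ 0) (h : q.1 ≠ 0) :
    toSphere q hq ≠ LinkSphere.pole := by
  refine ne_pole_of_fst_ne_zero (mul_ne_zero (pow_ne_zero 2 ?_) h)
  exact_mod_cast (sphereScale_pos hq).ne'

theorem fst_ne_zero_of_mem_knotSet {x : LinkSphere} (h : x ∈ knotSet) : x.1.1 ≠ 0 := fun h1 => by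
  have h2 : x.1.1 ^ 3 = x.1.2 ^ 2 := h
  have h3 : x.1.2 = 0 := pow_eq_zero_iff two_ne_zero |>.1 (by rw [← h2, h1]; simp)
  have := x.2
  rw [h1, h3] at this
  norm_num at this

theorem continuous_chart_comp {X : Type*} [TopologicalSpace X] {f : X → LinkSphere}
    (hf : Continuous f) (h : ∀ x, f x ≠ LinkSphere.pole) : Continuous fun x => chart (f x).1 := by
  rw [continuous_iff_continuousAt]
  exact fun x => ContinuousAt.comp (f := fun x => (f x).1)
    (continuousAt_chart (chartDen_ne_zero (h x))) (continuous_subtype_val.comp hf).continuousAt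

/-- The first two coordinates of a point of `ℝ³`, as a complex number. -/
def planeCoord (p : Fin 3 → ℝ) : ℂ := ⟨p 1, p 0⟩

theorem continuous_planeCoord : Continuous planeCoord := by
  have : planeCoord = fun p => (p 1 : ℂ) + p 0 * I := by
    ext p; apply Complex.ext <;> simp [planeCoord]
  rw [this]; fun_prop

/-- The linking number of the disjoint closed curves `z` and `k` is `n`. -/
def LinkingDegree (z k : ℝ → Fin 3 → ℝ) (n : ℤ) : Prop :=
  HasDegree (fun x => z x.1 2 - k x.2 2) (fun x => planeCoord (z x.1) - planeCoord (k x.2)) n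

theorem LinkingDegree.homotopy {z k : ℝ × ℝ → Fin 3 → ℝ} (hz : Continuous z) (hk : Continuous k)
    (hz' : ∀ τ s, z (τ, s + 2 * Real.pi) = z (τ, s))
    (hk' : ∀ τ s, k (τ, s + 2 * Real.pi) = k (τ, s)) (h : ∀ τ s σ, z (τ, s) ≠ k (τ, σ)) {n : ℤ}
    {τ₀ : ℝ} (τ₁ : ℝ) (hn : LinkingDegree (fun s => z (τ₀, s)) (fun s => k (τ₀, s)) n) :
    LinkingDegree (fun s => z (τ₁, s)) (fun s => k (τ₁, s)) n := by
  have c1 : Continuous fun x : ℝ × ℝ × ℝ => z (x.1, x.2.1) := by fun_prop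
  have c2 : Continuous fun x : ℝ × ℝ × ℝ => k (x.1, x.2.2) := by fun_prop
  refine HasDegree.homotopy (C := fun x => z (x.1, x.2.1) 2 - k (x.1, x.2.2) 2)
    (D := fun x => planeCoord (z (x.1, x.2.1)) - planeCoord (k (x.1, x.2.2)))
    (τ₀ := τ₀) ?_ ?_ ?_ ?_ ?_ ?_ ?_ τ₁ hn
  · exact ((continuous_apply 2).comp c1).sub ((continuous_apply 2).comp c2)
  · exact (continuous_planeCoord.comp c1).sub (continuous_planeCoord.comp c2)
  · intro τ s σ; simp only [hz']
  · intro τ s σ; simp only [hz']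
  · intro τ s σ; simp only [hk']
  · intro τ s σ; simp only [hk']
  · rintro ⟨τ, s, σ⟩ e1 e2
    refine h τ s σ ?_
    have e3 := sub_eq_zero.1 e2
    ext i
    fin_cases i
    · exact congrArg im e3
    · exact congrArg re e3
    · exact sub_eq_zero.1 e1

theorem LinkingDegree.reflect {z k : ℝ → Fin 3 → ℝ} {n : ℤ} (h : LinkingDegree z k n) :
    LinkingDegree (fun s => _root_.mirror (z s)) (fun s => _root_.mirror (k s)) (-n) := by
  have := HasDegree.mirror h
  rw [LinkingDegree]
  convert this using 1
  · ext x
    simp [_root_.mirror]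
    ring
  · rfl

theorem exp_pair_ne_zero (a b : ℂ) : ((exp a, b) : ℂ × ℂ) ≠ 0 := fun h =>
  exp_ne_zero a (congrArg Prod.fst h)

/-- The point of `LinkSphere` at position `M` along the trefoil displaced transversally by `ξ`;
both coordinates are logarithmic. -/
noncomputable def stdPoint (M ξ : ℂ) : LinkSphere :=
  toSphere (exp (2 * M + ξ / 3), exp (3 * M)) (exp_pair_ne_zero _ _)

theorem Continuous.stdPoint {X : Type*} [TopologicalSpace X] {f g : X → ℂ} (hf : Continuous f)
    (hg : Continuous g) : Continuous fun x => stdPoint (f x) (g x) :=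
  Continuous.toSphere (f := fun x => (exp (2 * f x + g x / 3), exp (3 * f x))) (by fun_prop) _

theorem stdPoint_congr {M M' ξ ξ' : ℂ} (h : exp M = exp M') (hξ : ξ = ξ') :
    stdPoint M ξ = stdPoint M' ξ' := by
  refine toSphere_congr ?_ _
  have h2 : exp (2 * M) = exp (2 * M') := by
    rw [two_mul, two_mul, exp_add, exp_add, h]
  have h3 : exp (3 * M) = exp (3 * M') := by
    rw [show 3 * M = 2 * M + M by ring, show 3 * M' = 2 * M' + M' by ring, exp_add, exp_add, h, h2]
  rw [exp_add, exp_add, h2, h3, hξ]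

theorem stdPoint_mem_knotSet {M ξ : ℂ} : stdPoint M ξ ∈ knotSet ↔ exp ξ = 1 := by
  rw [stdPoint, toSphere_mem_knotSet]
  dsimp only
  rw [← exp_nat_mul, ← exp_nat_mul]
  have h1 : ((3 : ℕ) : ℂ) * (2 * M + ξ / 3) = 6 * M + ξ := by push_cast; ring
  have h2 : ((2 : ℕ) : ℂ) * (3 * M) = 6 * M := by push_cast; ring
  rw [h1, h2, exp_add]
  exact mul_eq_left₀ (exp_ne_zero _)

theorem stdPoint_ne_pole (M ξ : ℂ) : stdPoint M ξ ≠ LinkSphere.pole :=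
  toSphere_ne_pole _ (exp_ne_zero _)

theorem stdPoint_unit (θ : ℝ) : (stdPoint (I * θ) 0).1 = (exp (2 * (I * θ)), exp (3 * (I * θ))) := by
  have hq : ((exp (2 * (I * θ)), exp (3 * (I * θ))) : ℂ × ℂ) ≠ 0 := exp_pair_ne_zero _ _
  have h1 : ‖exp (2 * (I * θ))‖ = 1 := by
    rw [show 2 * (I * θ) = ((2 * θ : ℝ) : ℂ) * I by push_cast; ring, norm_exp_ofReal_mul_I]
  have h2 : ‖exp (3 * (I * θ))‖ = 1 := by
    rw [show 3 * (I * θ) = ((3 * θ : ℝ) : ℂ) * I by push_cast; ring, norm_exp_ofReal_mul_I]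
  have h := toSphere_of_mem (x := ⟨(exp (2 * (I * θ)), exp (3 * (I * θ))), by
    simp only [h1, h2]; norm_num⟩) hq
  rw [stdPoint]
  rw [toSphere_congr (q' := (exp (2 * (I * θ)), exp (3 * (I * θ)))) (by simp), h]

theorem chartRatio_stdPoint_unit (θ : ℝ) :
    chartRatio (stdPoint (I * θ) 0).1 = -exp (3 * (I * θ)) := by
  have h2 : ‖exp (3 * (I * θ))‖ = 1 := by
    rw [show 3 * (I * θ) = ((3 * θ : ℝ) : ℂ) * I by push_cast; ring, norm_exp_ofReal_mul_I]
  rw [stdPoint_unit, chartRatio]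
  dsimp only
  rw [h2, ofReal_one, mul_one, chartNum, chartDen, normSq_eq_norm_sq, h2]
  push_cast
  ring

theorem chartPlane_stdPoint_unit (θ : ℝ) : chartPlane (stdPoint (I * θ) 0).1 =
    -exp (I * θ) - 2 * exp (-(2 * (I * θ))) := by
  have h1 : ‖exp (2 * (I * θ))‖ = 1 := by
    rw [show 2 * (I * θ) = ((2 * θ : ℝ) : ℂ) * I by push_cast; ring, norm_exp_ofReal_mul_I]
  have h2 : ‖exp (3 * (I * θ))‖ = 1 := by
    rw [show 3 * (I * θ) = ((3 * θ : ℝ) : ℂ) * I by push_cast; ring, norm_exp_ofReal_mul_I]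
  have h3 : conj (exp (2 * (I * θ))) = exp (-(2 * (I * θ))) := by
    rw [show 2 * (I * θ) = ((2 * θ : ℝ) : ℂ) * I by push_cast; ring, ← exp_conj,
      map_mul, conj_ofReal, conj_I, mul_neg]
  rw [chartPlane, chartRatio_stdPoint_unit, stdPoint_unit, chartAux]
  dsimp only
  rw [h1, h2, h3]
  have h4 : exp (3 * (I * θ)) * exp (-(2 * (I * θ))) = exp (I * θ) := by
    rw [← exp_add]; congr 1; ring
  norm_num
  linear_combination -h4

theorem chartRatio_core (A : ℂ) : chartRatio (A, 0) = 1 / 2 := by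
  simp [chartRatio, chartNum, chartDen]

theorem chartPlane_core {q : ℂ × ℂ} (hq : q ≠ 0) (h2 : q.2 = 0) {r : ℝ} (hr : 0 < r) {θ : ℝ}
    (h1 : q.1 = r * exp (2 * (I * θ))) :
    chartPlane (toSphere q hq).1 = -(√3 : ℝ) * exp (-(2 * (I * θ))) := by
  have h3 : conj (exp (2 * (I * θ))) = exp (-(2 * (I * θ))) := by
    rw [show 2 * (I * θ) = ((2 * θ : ℝ) : ℂ) * I by push_cast; ring, ← exp_conj,
      map_mul, conj_ofReal, conj_I, mul_neg]
  have hnorm : ‖exp (-(2 * (I * θ)))‖ = 1 := by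
    rw [show -(2 * (I * θ)) = ((-2 * θ : ℝ) : ℂ) * I by push_cast; ring, norm_exp_ofReal_mul_I]
  obtain ⟨A, hA⟩ : ∃ A, A = (toSphere q hq).1.1 := ⟨_, rfl⟩
  have hB : (toSphere q hq).1 = (A, 0) := Prod.ext hA.symm (by simp [toSphere, h2])
  have hmem := (toSphere q hq).2
  rw [hB] at hmem ⊢
  have hden : chartDen (((A, 0) : ℂ × ℂ).2 * ‖((A, 0) : ℂ × ℂ).2‖) ≠ 0 := by
    simp [chartDen]
  have hsq := normSq_chartPlane hmem hden
  have hs := sphereScale_pos hq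
  obtain ⟨c, hc0, hc⟩ : ∃ c : ℝ, 0 ≤ c ∧ chartPlane (A, 0) = -c * exp (-(2 * (I * θ))) := by
    refine ⟨3 / 2 * (sphereScale q ^ 2 * r * √‖A‖ * √((2 + ‖(0 : ℂ)‖ ^ 2) / 3)), by positivity, ?_⟩
    have hA' : A = (sphereScale q ^ 2 * r : ℝ) * exp (2 * (I * θ)) := by
      rw [hA]; simp only [toSphere, h1]; push_cast; ring
    have hAc : conj A = (sphereScale q ^ 2 * r : ℝ) * exp (-(2 * (I * θ))) := by
      rw [hA', map_mul, h3, conj_ofReal]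
    rw [chartPlane, chartRatio_core, chartAux]
    dsimp only
    rw [hAc]
    push_cast
    ring
  rw [hc, normSq_eq_norm_sq, norm_mul, hnorm, norm_neg, norm_real, Real.norm_eq_abs, mul_one,
    sq_abs, chartRatio_core] at hsq
  norm_num at hsq
  rw [hc, ← Real.sqrt_sq hc0, hsq]

theorem chart_core_two {q : ℂ × ℂ} (hq : q ≠ 0) (h2 : q.2 = 0) : chart (toSphere q hq).1 2 = 0 := by
  have hB : (toSphere q hq).1 = ((toSphere q hq).1.1, 0) := Prod.ext rfl (by simp [toSphere, h2])
  have : chart (toSphere q hq).1 2 = -(chartRatio (toSphere q hq).1).im := rfl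
  rw [this, hB, chartRatio_core]
  norm_num

theorem planeCoord_chart (q : ℂ × ℂ) : planeCoord (chart q) = chartPlane q := rfl

theorem chart_two (q : ℂ × ℂ) : chart q 2 = -(chartRatio q).im := rfl

/-- The projection of the line to the unit interval. -/
def unitClamp (τ : ℝ) : ℝ := max 0 (min τ 1)

theorem continuous_unitClamp : Continuous unitClamp := by unfold unitClamp; fun_prop

theorem unitClamp_nonneg (τ : ℝ) : 0 ≤ unitClamp τ := le_max_left _ _

theorem unitClamp_le_one (τ : ℝ) : unitClamp τ ≤ 1 := max_le zero_le_one (min_le_right _ _)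

theorem unitClamp_zero : unitClamp 0 = 0 := by simp [unitClamp]

theorem unitClamp_one : unitClamp 1 = 1 := by simp [unitClamp]

theorem norm_exp_neg_two_I (δ : ℤ) (x : ℝ) : ‖exp (-(2 * I * δ * x))‖ = 1 := by
  rw [show -(2 * I * δ * x) = ((-(2 * δ * x) : ℝ) : ℂ) * I by push_cast; ring,
    norm_exp_ofReal_mul_I]

theorem exp_int_periodic (k : ℤ) (s : ℝ) : exp (I * k * (s + 2 * Real.pi : ℝ)) = exp (I * k * s) := by
  rw [show I * k * (s + 2 * Real.pi : ℝ) = I * k * s + I * (2 * Real.pi * k) by push_cast; ring,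
    exp_add, exp_two_pi_int, mul_one]

theorem sin_int_periodic (k : ℤ) (s : ℝ) :
    Real.sin (k * (s + 2 * Real.pi)) = Real.sin (k * s) := by
  rw [mul_add, Real.sin_add_int_mul_two_pi]

theorem cos_int_periodic (k : ℤ) (s : ℝ) :
    Real.cos (k * (s + 2 * Real.pi)) = Real.cos (k * s) := by
  rw [mul_add, Real.cos_add_int_mul_two_pi]

theorem hasDegree_cable_core (δ : ℤ) : HasDegree (fun x => -Real.sin (3 * δ * x.2))
    (fun x => exp (I * δ * x.2) + 2 * exp (-(2 * I * δ * x.2)) -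
      (√3 : ℝ) * exp (-(2 * I * δ * x.1))) (6 * δ ^ 2) := by
  have hE : ∀ s : ℝ, exp (-(2 * I * δ * (s + 2 * Real.pi : ℝ))) = exp (-(2 * I * δ * s)) :=
    fun s => by
      have := exp_int_periodic (-2 * δ) s
      convert this using 2 <;> push_cast <;> ring
  have hS : ∀ s : ℝ, Real.sin (3 * δ * (s + 2 * Real.pi)) = Real.sin (3 * δ * s) := fun s => by
    simpa using sin_int_periodic (3 * δ) s
  have hC : ∀ s : ℝ, Real.cos (3 * δ * (s + 2 * Real.pi)) = Real.cos (3 * δ * s) := fun s => by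
    simpa using cos_int_periodic (3 * δ) s
  have hcl := continuous_unitClamp
  have key := HasDegree.homotopy (C := fun x => -Real.sin (3 * δ * x.2.2))
    (D := fun x => (1 - unitClamp x.1) * (exp (I * δ * x.2.2) + 2 * exp (-(2 * I * δ * x.2.2)) -
        (√3 : ℝ) * exp (-(2 * I * δ * x.2.1))) + unitClamp x.1 *
      ((max (Real.cos (3 * δ * x.2.2)) 0 : ℝ) * exp (-(2 * I * δ * x.2.2)) -
        (max (-Real.cos (3 * δ * x.2.2)) 0 : ℝ) * exp (-(2 * I * δ * x.2.1))))
    (n := 6 * δ ^ 2) (τ₀ := 1) (by fun_prop) (by fun_prop) (fun _ _ _ => rfl)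
    (fun τ s σ => by dsimp only; rw [hE]) (fun τ s σ => by dsimp only; rw [hS])
    (fun τ s σ => by dsimp only; rw [hE, hC, exp_int_periodic]) ?_ 0 ?_
  · simpa only [unitClamp_zero, ofReal_zero, sub_zero, one_mul, zero_mul, add_zero] using key
  · rintro ⟨τ, s, σ⟩ h0 h1
    dsimp only at h0 h1
    have hsin : Real.sin (3 * δ * σ) = 0 := neg_eq_zero.1 h0
    have hnσ := norm_exp_neg_two_I δ σ
    have hns := norm_exp_neg_two_I δ s
    have ht0 := unitClamp_nonneg τ
    have ht1 := unitClamp_le_one τ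
    have h3 : 1 < √3 := Real.lt_sqrt_of_sq_lt (by norm_num)
    have h3' : √3 < 3 := (Real.sqrt_lt' (by norm_num)).2 (by norm_num)
    have he : exp (I * δ * σ) = Real.cos (3 * δ * σ) * exp (-(2 * I * δ * σ)) := by
      have : exp ((3 * δ * σ : ℝ) * I) = Real.cos (3 * δ * σ) := by
        rw [exp_mul_I, ← ofReal_cos, ← ofReal_sin, hsin]; simp
      rw [← this, ← exp_add]; congr 1; push_cast; ring
    rw [he] at h1
    generalize exp (-(2 * I * δ * σ)) = E at *
    generalize exp (-(2 * I * δ * s)) = E' at *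
    generalize unitClamp τ = t at *
    have hcase : ∀ a b : ℝ, (a : ℂ) * E = b * E' → |a| = |b| := fun a b h => by
      have := congrArg norm h
      simpa [hnσ, hns] using this
    rcases Real.sin_eq_zero_iff_cos_eq.1 hsin with hc | hc
    · rw [hc] at h1
      have := hcase (3 - 2 * t) ((1 - t) * √3) (by
        norm_num at h1
        push_cast
        linear_combination h1)
      rw [abs_of_nonneg (by linarith), abs_of_nonneg (by nlinarith)] at this
      nlinarith
    · rw [hc] at h1
      have := hcase (1 - t) ((1 - t) * √3 + t) (by
        norm_num at h1
        push_cast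
        linear_combination h1)
      rw [abs_of_nonneg (by linarith), abs_of_nonneg (by nlinarith)] at this
      nlinarith
  · simpa only [unitClamp_one, ofReal_one, sub_self, one_mul, zero_mul, zero_add] using
      hasDegree_cable_model δ

theorem linkingDegree_stdPoint (δ : ℤ) {ρ : ℝ} (hρ : 0 < ρ) :
    LinkingDegree (fun s => chart (stdPoint (I * (δ * s : ℝ)) ρ).1)
      (fun σ => chart (stdPoint (I * (δ * σ : ℝ)) 0).1) (6 * δ ^ 2) := by
  have hcl := continuous_unitClamp
  have hper : ∀ s : ℝ, exp (I * (δ * (s + 2 * Real.pi) : ℝ)) = exp (I * (δ * s : ℝ)) := fun s => by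
    have := exp_int_periodic δ s
    push_cast at this ⊢
    simpa only [mul_assoc] using this
  have hper2 : ∀ (s : ℝ) (k : ℕ), exp (k * (I * (δ * (s + 2 * Real.pi) : ℝ))) =
      exp (k * (I * (δ * s : ℝ))) := fun s k => by rw [exp_nat_mul, exp_nat_mul, hper]
  have hk : Continuous fun x : ℝ × ℝ => stdPoint (I * (δ * x.2 : ℝ)) 0 :=
    Continuous.stdPoint (by fun_prop) (by fun_prop)
  let q : ℝ × ℝ → ℂ × ℂ := fun x => (exp (2 * (I * (δ * x.2 : ℝ)) + ρ / 3),
    unitClamp x.1 * exp (3 * (I * (δ * x.2 : ℝ))))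
  have hq : ∀ x, q x ≠ 0 := fun x => exp_pair_ne_zero _ _
  have hqc : Continuous q := by simp only [q]; fun_prop
  have key := LinkingDegree.homotopy (z := fun x => chart (toSphere (q x) (hq x)).1)
    (k := fun x => chart (stdPoint (I * (δ * x.2 : ℝ)) 0).1) (n := 6 * δ ^ 2) (τ₀ := 0)
    (continuous_chart_comp (hqc.toSphere hq) fun x => toSphere_ne_pole _ (exp_ne_zero _))
    (continuous_chart_comp hk fun x => stdPoint_ne_pole _ _) (fun τ s => ?_) (fun τ s => ?_)
    (fun τ s σ h => ?_) 1 ?_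
  · simp only [q, unitClamp_one, ofReal_one, one_mul] at key
    exact key
  · rw [toSphere_congr (q := q (τ, s + 2 * Real.pi)) (q' := q (τ, s))]
    simp only [q]
    have h2 := hper2 s 2
    have h3 := hper2 s 3
    norm_num only [Nat.cast_ofNat] at h2 h3
    rw [exp_add, exp_add, h2, h3]
  · dsimp only
    rw [stdPoint_congr (hper s) rfl]
  · have h1 := chart_injective (toSphere_ne_pole _ (exp_ne_zero _)) (stdPoint_ne_pole _ _) h
    have h2 : stdPoint (I * (δ * σ : ℝ)) 0 ∈ knotSet := stdPoint_mem_knotSet.2 exp_zero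
    rw [← h1, toSphere_mem_knotSet] at h2
    have h3 := congrArg norm h2
    simp only [q, norm_pow, norm_mul, norm_exp, norm_real, Real.norm_eq_abs] at h3
    have e1 : (2 * (I * (δ * s : ℝ)) + ρ / 3 : ℂ).re = ρ / 3 := by
      have : (2 * (I * (δ * s : ℝ)) + ρ / 3 : ℂ) = ((2 * (δ * s) : ℝ) : ℂ) * I + (ρ / 3 : ℝ) := by
        push_cast; ring
      rw [this, add_re, re_ofReal_mul, I_re, ofReal_re]; ring
    have e2 : (3 * (I * (δ * s : ℝ)) : ℂ).re = 0 := by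
      have : (3 * (I * (δ * s : ℝ)) : ℂ) = ((3 * (δ * s) : ℝ) : ℂ) * I := by
        push_cast; ring
      rw [this, re_ofReal_mul, I_re]; ring
    rw [e1, e2, Real.exp_zero, mul_one, sq_abs] at h3
    have h4 : 1 < Real.exp (ρ / 3) ^ 3 :=
      one_lt_pow₀ (Real.one_lt_exp_iff.2 (by positivity)) three_ne_zero
    have h5 : unitClamp τ ^ 2 ≤ 1 := pow_le_one₀ (unitClamp_nonneg τ) (unitClamp_le_one τ)
    linarith
  · rw [LinkingDegree]
    have hq2 : ∀ s, (q (0, s)).2 = 0 := fun s => by simp [q, unitClamp_zero]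
    convert hasDegree_cable_core δ using 1
    · ext x
      rw [chart_core_two _ (hq2 _), chart_two, chartRatio_stdPoint_unit]
      rw [show 3 * (I * ((δ * x.2 : ℝ) : ℂ)) = ((3 * δ * x.2 : ℝ) : ℂ) * I by push_cast; ring,
        neg_im, exp_ofReal_mul_I_im]
      ring
    · ext1 x
      rw [planeCoord_chart, planeCoord_chart, chartPlane_stdPoint_unit,
        chartPlane_core _ (hq2 _) (Real.exp_pos (ρ / 3)) (θ := δ * x.1)
        (by simp only [q]; rw [exp_add]; push_cast; ring)]
      have a1 : I * ((δ * x.2 : ℝ) : ℂ) = I * δ * x.2 := by push_cast; ring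
      have a2 : 2 * (I * ((δ * x.1 : ℝ) : ℂ)) = 2 * I * δ * x.1 := by push_cast; ring
      have a3 : 2 * (I * δ * x.2) = 2 * I * δ * x.2 := by ring
      rw [a1, a2, a3]
      ring

/-- A neighbourhood of `knotSet` on which `tubeLog` and `tubeUnit` are continuous. -/
def knotTube : Set LinkSphere := {x | ‖x.1.1 ^ 3 - x.1.2 ^ 2‖ < ‖x.1.2‖ ^ 2 / 2}

/-- The logarithmic transverse coordinate near the trefoil. -/
noncomputable def tubeLog (x : LinkSphere) : ℂ := log (x.1.1 ^ 3 / x.1.2 ^ 2)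

/-- The longitudinal coordinate near the trefoil. -/
noncomputable def tubeUnit (x : LinkSphere) : ℂ := x.1.2 * exp (tubeLog x / 3) / x.1.1

theorem isOpen_knotTube : IsOpen knotTube :=
  isOpen_lt (by fun_prop) (by fun_prop)

theorem knotSet_subset_knotTube : knotSet ⊆ knotTube := fun x hx => by
  have h : x.1.1 ^ 3 = x.1.2 ^ 2 := hx
  have h1 := fst_ne_zero_of_mem_knotSet hx
  have h2 : x.1.2 ≠ 0 := fun h2 => pow_ne_zero 3 h1 (by rw [h, h2]; simp)
  have := norm_pos_iff.2 h2
  show ‖x.1.1 ^ 3 - x.1.2 ^ 2‖ < ‖x.1.2‖ ^ 2 / 2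
  rw [h, sub_self, norm_zero]
  positivity

theorem snd_ne_zero_of_mem_knotTube {x : LinkSphere} (hx : x ∈ knotTube) : x.1.2 ≠ 0 := fun h => by
  have h1 : ‖x.1.1 ^ 3 - x.1.2 ^ 2‖ < ‖x.1.2‖ ^ 2 / 2 := hx
  rw [h, norm_zero] at h1
  norm_num at h1
  have : 0 ≤ ‖x.1.1‖ ^ 3 := by positivity
  linarith

theorem norm_ratio_sub_one_lt {x : LinkSphere} (hx : x ∈ knotTube) :
    ‖x.1.1 ^ 3 / x.1.2 ^ 2 - 1‖ < 1 / 2 := by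
  have h1 : ‖x.1.1 ^ 3 - x.1.2 ^ 2‖ < ‖x.1.2‖ ^ 2 / 2 := hx
  have h2 := snd_ne_zero_of_mem_knotTube hx
  have h3 := norm_pos_iff.2 h2
  rw [div_sub_one (pow_ne_zero 2 h2), norm_div, norm_pow, div_lt_iff₀ (by positivity)]
  linarith

theorem tube_ratio_mem_slitPlane {x : LinkSphere} (hx : x ∈ knotTube) :
    x.1.1 ^ 3 / x.1.2 ^ 2 ∈ slitPlane := by
  have := mem_slitPlane_of_norm_lt_one ((norm_ratio_sub_one_lt hx).trans (by norm_num))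
  simpa using this

theorem fst_ne_zero_of_mem_knotTube {x : LinkSphere} (hx : x ∈ knotTube) : x.1.1 ≠ 0 := fun h => by
  have := slitPlane_ne_zero (tube_ratio_mem_slitPlane hx)
  simp [h] at this

theorem norm_tubeLog_lt {x : LinkSphere} (hx : x ∈ knotTube) : ‖tubeLog x‖ < 1 := by
  have h := norm_ratio_sub_one_lt hx
  have := norm_log_one_add_half_le_self h.le
  rw [add_sub_cancel] at this
  rw [tubeLog]
  linarith

theorem exp_tubeLog {x : LinkSphere} (hx : x ∈ knotTube) :
    exp (tubeLog x) = x.1.1 ^ 3 / x.1.2 ^ 2 :=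
  exp_log (slitPlane_ne_zero (tube_ratio_mem_slitPlane hx))

theorem tubeUnit_ne_zero {x : LinkSphere} (hx : x ∈ knotTube) : tubeUnit x ≠ 0 :=
  div_ne_zero (mul_ne_zero (snd_ne_zero_of_mem_knotTube hx) (exp_ne_zero _))
    (fst_ne_zero_of_mem_knotTube hx)

theorem tubeLog_eq_zero {x : LinkSphere} (hx : x ∈ knotSet) : tubeLog x = 0 := by
  have h : x.1.1 ^ 3 = x.1.2 ^ 2 := hx
  have h2 := snd_ne_zero_of_mem_knotTube (knotSet_subset_knotTube hx)
  rw [tubeLog, h, div_self (pow_ne_zero 2 h2), log_one]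

theorem tubeLog_ne_zero {x : LinkSphere} (hx : x ∈ knotTube) (h : x ∉ knotSet) : tubeLog x ≠ 0 :=
  fun h0 => h <| by
    have h1 := exp_tubeLog hx
    rw [h0, exp_zero, eq_div_iff (pow_ne_zero 2 (snd_ne_zero_of_mem_knotTube hx)), one_mul] at h1
    exact h1.symm

theorem continuousOn_tubeLog : ContinuousOn tubeLog knotTube := by
  refine ContinuousOn.clog ?_ fun x hx => tube_ratio_mem_slitPlane hx
  exact ContinuousOn.div (by fun_prop) (by fun_prop)
    fun x hx => pow_ne_zero 2 (snd_ne_zero_of_mem_knotTube hx)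

theorem continuousOn_tubeUnit : ContinuousOn tubeUnit knotTube := by
  have := continuousOn_tubeLog
  exact ContinuousOn.div (by fun_prop) (by fun_prop) fun x hx => fst_ne_zero_of_mem_knotTube hx

theorem eq_stdPoint {x : LinkSphere} (hx : x ∈ knotTube) {M : ℂ} (hM : exp M = tubeUnit x) :
    x = stdPoint M (tubeLog x) := by
  have h1 := fst_ne_zero_of_mem_knotTube hx
  have h2 := snd_ne_zero_of_mem_knotTube hx
  have hx0 : x.1 ≠ 0 := fun h => h1 (congrArg Prod.fst h)
  have he : exp (tubeLog x / 3) ^ 3 = x.1.1 ^ 3 / x.1.2 ^ 2 := by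
    rw [← exp_nat_mul, ← exp_tubeLog hx]
    congr 1
    push_cast
    ring
  rw [stdPoint, ← toSphere_of_mem hx0]
  conv_rhs => rw [toSphere_of_mem hx0]
  refine toSphere_congr (Prod.ext ?_ ?_) _
  · dsimp only
    rw [exp_add, show 2 * M = (2 : ℕ) * M by norm_num, exp_nat_mul, hM, tubeUnit]
    rw [eq_div_iff (pow_ne_zero 2 h2)] at he
    field_simp
    linear_combination -he
  · dsimp only
    rw [show 3 * M = (3 : ℕ) * M by norm_num, exp_nat_mul, hM, tubeUnit, div_pow, mul_pow, he]
    field_simp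

theorem exp_I_periodic (s : ℝ) : exp (I * (s + 2 * Real.pi : ℝ)) = exp (I * s) := by
  simpa using exp_int_periodic 1 s

/-- A homeomorphism preserving the trefoil maps a short transverse annulus to a curve family which
is described by logarithmic coordinates. -/
theorem exists_peripheral_logs (H : LinkSphere ≃ₜ LinkSphere)
    (hH : ∀ x, H x ∈ knotSet ↔ x ∈ knotSet) :
    ∃ (ρ : ℝ) (δ n : ℤ) (M M' L : ℝ → ℂ), 0 < ρ ∧ Continuous M ∧ Continuous M' ∧ Continuous L ∧
      (∀ s : ℝ, H (stdPoint (I * s) ρ) = stdPoint (M s) (exp (L s))) ∧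
      (∀ s : ℝ, H (stdPoint (I * s) 0) = stdPoint (M' s) 0) ∧
      (∀ s, (L s).re < 0) ∧
      (∀ s, M (s + 2 * Real.pi) = M s + δ * (2 * Real.pi * I)) ∧
      (∀ s, M' (s + 2 * Real.pi) = M' s + δ * (2 * Real.pi * I)) ∧
      (∀ s, L (s + 2 * Real.pi) = L s + n * (2 * Real.pi * I)) := by
  have hc : Continuous fun p : ℝ × ℝ => H (stdPoint (I * p.2) p.1) :=
    H.continuous.comp (Continuous.stdPoint (by fun_prop) (by fun_prop))
  have hper : ∀ s ρ : ℝ, stdPoint (I * (s + 2 * Real.pi : ℝ)) ρ = stdPoint (I * s) ρ := fun s ρ =>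
    stdPoint_congr (exp_I_periodic s) rfl
  have hev : ∀ᶠ ρ : ℝ in 𝓝 0, ∀ s ∈ Set.Icc (0 : ℝ) (2 * Real.pi),
      H (stdPoint (I * s) ρ) ∈ knotTube := by
    refine isCompact_Icc.eventually_forall_of_forall_eventually fun s _ => ?_
    refine hc.continuousAt.eventually_mem (isOpen_knotTube.mem_nhds ?_)
    refine knotSet_subset_knotTube ((hH _).2 (stdPoint_mem_knotSet.2 ?_))
    simp
  obtain ⟨ε, hε, hball⟩ := Metric.eventually_nhds_iff.1 hev
  have hmem : ∀ ρ s : ℝ, |ρ| < ε → H (stdPoint (I * s) ρ) ∈ knotTube := fun ρ s hρ => by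
    have hp : Function.Periodic (fun s : ℝ => H (stdPoint (I * s) ρ)) (2 * Real.pi) := fun s => by
      dsimp only
      rw [hper]
    obtain ⟨y, hy, he⟩ := hp.exists_mem_Ico₀ Real.two_pi_pos s
    have he' : H (stdPoint (I * s) ρ) = H (stdPoint (I * y) ρ) := he
    rw [he']
    exact hball (by simpa using hρ) y ⟨hy.1, hy.2.le⟩
  let G : ℝ × ℝ → LinkSphere := fun x => H (stdPoint (I * x.1) (ε / 2 * unitClamp x.2 : ℝ))
  have hGc : Continuous G := by
    have := continuous_unitClamp
    exact H.continuous.comp (Continuous.stdPoint (by fun_prop) (by fun_prop))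
  have hG : ∀ x, G x ∈ knotTube := fun x => by
    refine hmem _ _ ?_
    have h0 := unitClamp_nonneg x.2
    have h1 := unitClamp_le_one x.2
    rw [abs_of_nonneg (by positivity)]
    nlinarith
  have hGper : ∀ s τ, G (s + 2 * Real.pi, τ) = G (s, τ) := fun s τ => congrArg H (hper s _)
  obtain ⟨N, hN, hNe⟩ := exists_continuous_log (fun x => tubeUnit (G x))
    (continuousOn_tubeUnit.comp_continuous hGc hG) fun x => tubeUnit_ne_zero (hG x)
  obtain ⟨δ, hδ⟩ := exists_int_period_log _ N hN hNe (2 * Real.pi) fun s τ => by rw [hGper]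
  have hG1 : ∀ s, G (s, 1) ∉ knotSet := fun s => by
    rw [hH, stdPoint_mem_knotSet, unitClamp_one, mul_one, ← ofReal_exp]
    norm_cast
    rw [Real.exp_eq_one_iff]
    positivity
  obtain ⟨L, hL, hLe⟩ := exists_continuous_log (fun x => tubeLog (G (x.1, 1)))
    (continuousOn_tubeLog.comp_continuous (by fun_prop) fun x => hG _)
    fun x => tubeLog_ne_zero (hG _) (hG1 _)
  obtain ⟨n, hn⟩ := exists_int_period_log _ L hL hLe (2 * Real.pi) fun s τ => by rw [hGper]
  refine ⟨ε / 2, δ, n, fun s => N (s, 1), fun s => N (s, 0), fun s => L (s, 0), by positivity,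
    by fun_prop, by fun_prop, by fun_prop, fun s => ?_, fun s => ?_, fun s => ?_,
    fun s => hδ s 1, fun s => hδ s 0, fun s => hn s 0⟩
  · have h := eq_stdPoint (hG (s, 1)) (hNe (s, 1))
    rw [← hLe (s, 0)] at h
    rw [← h]
    simp only [G, unitClamp_one, mul_one]
  · have h := eq_stdPoint (hG (s, 0)) (hNe (s, 0))
    have hk : G (s, 0) ∈ knotSet := by
      rw [hH, stdPoint_mem_knotSet, unitClamp_zero]
      simp
    rw [tubeLog_eq_zero hk] at h
    rw [← h]
    simp only [G, unitClamp_zero, mul_zero, ofReal_zero]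
  · have h := norm_tubeLog_lt (hG (s, 1))
    rw [← hLe (s, 0), norm_exp, Real.exp_lt_one_iff] at h
    exact h

/-- The linear homotopy from `M` to the affine function `s ↦ a + k s i`. -/
noncomputable def blend (M : ℝ → ℂ) (a : ℝ) (k : ℤ) (x : ℝ × ℝ) : ℂ :=
  M x.1 + unitClamp x.2 * (a + I * (k * x.1 : ℝ) - M x.1)

section blend

variable {M : ℝ → ℂ} {a : ℝ} {k : ℤ}

theorem continuous_blend (hM : Continuous M) : Continuous (blend M a k) := by
  have := continuous_unitClamp
  unfold blend
  fun_prop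

theorem blend_zero (s : ℝ) : blend M a k (s, 0) = M s := by
  simp [blend, unitClamp_zero]

theorem blend_one (s : ℝ) : blend M a k (s, 1) = a + I * (k * s : ℝ) := by
  simp [blend, unitClamp_one]

theorem exp_blend_periodic (hM : ∀ s, M (s + 2 * Real.pi) = M s + k * (2 * Real.pi * I))
    (s τ : ℝ) : exp (blend M a k (s + 2 * Real.pi, τ)) = exp (blend M a k (s, τ)) := by
  have : blend M a k (s + 2 * Real.pi, τ) = blend M a k (s, τ) + I * (2 * Real.pi * k) := by
    simp only [blend, hM]
    push_cast
    ring
  rw [this, exp_add, exp_two_pi_int, mul_one]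

theorem blend_re_neg (hM : ∀ s, (M s).re < 0) (ha : a < 0) (x : ℝ × ℝ) :
    (blend M a k x).re < 0 := by
  have h : (blend M a k x).re = (1 - unitClamp x.2) * (M x.1).re + unitClamp x.2 * a := by
    simp [blend]
    ring
  have h0 := unitClamp_nonneg x.2
  have h1 := unitClamp_le_one x.2
  have h2 := hM x.1
  rw [h]
  rcases h0.eq_or_lt with h0 | h0
  · rw [← h0]; linarith
  · nlinarith [mul_nonneg (sub_nonneg.2 h1) (neg_nonneg.2 h2.le), mul_pos h0 (neg_pos.2 ha)]

end blend

theorem exp_exp_ne_one {L : ℂ} (hL : L.re < 0) : exp (exp L) ≠ 1 := fun h => by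
  obtain ⟨n, hn⟩ := exp_eq_one_iff.1 h
  have h1 : ‖exp L‖ < 1 := by rwa [norm_exp, Real.exp_lt_one_iff]
  have h2 : n ≠ 0 := fun h0 => exp_ne_zero L (by rw [hn, h0]; simp)
  have h3 : (1 : ℝ) ≤ |(n : ℝ)| := by exact_mod_cast Int.one_le_abs h2
  rw [hn] at h1
  simp only [norm_mul, norm_intCast, norm_I, mul_one, norm_real, Real.norm_eq_abs,
    abs_of_pos Real.pi_pos, RCLike.norm_ofNat] at h1
  nlinarith [Real.pi_gt_three]

theorem norm_exp_mul_I_mul (k : ℝ) (s : ℝ) : ‖exp (k * (I * s))‖ = 1 := by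
  rw [show k * (I * s) = ((k * s : ℝ) : ℂ) * I by push_cast; ring, norm_exp_ofReal_mul_I]

/-- The circle action on `LinkSphere` which moves the trefoil along itself. -/
noncomputable def rotate (s : ℝ) (x : LinkSphere) : LinkSphere :=
  ⟨(exp (2 * (I * s)) * x.1.1, exp (3 * (I * s)) * x.1.2), by
    have h2 := norm_exp_mul_I_mul 2 s
    have h3 := norm_exp_mul_I_mul 3 s
    push_cast at h2 h3
    simp only [norm_mul, h2, h3, one_mul]
    exact x.2⟩

theorem continuous_rotate : Continuous fun x : ℝ × LinkSphere => rotate x.1 x.2 :=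
  Continuous.subtype_mk (by fun_prop) _

theorem rotate_periodic (s : ℝ) : rotate (s + 2 * Real.pi) = rotate s := by
  funext x
  have h := exp_I_periodic s
  refine Subtype.ext (Prod.ext ?_ ?_) <;>
  simp only [rotate, show (2 : ℂ) = (2 : ℕ) by norm_num, show (3 : ℂ) = (3 : ℕ) by norm_num,
    exp_nat_mul, h]

theorem rotate_zero (x : LinkSphere) : rotate 0 x = x :=
  Subtype.ext (Prod.ext (by simp [rotate]) (by simp [rotate]))

theorem rotate_mem_knotSet {s : ℝ} {x : LinkSphere} : rotate s x ∈ knotSet ↔ x ∈ knotSet := by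
  show (exp (2 * (I * s)) * x.1.1) ^ 3 = (exp (3 * (I * s)) * x.1.2) ^ 2 ↔ x.1.1 ^ 3 = x.1.2 ^ 2
  rw [mul_pow, mul_pow, ← exp_nat_mul, ← exp_nat_mul,
    show ((3 : ℕ) : ℂ) * (2 * (I * s)) = (2 : ℕ) * (3 * (I * s)) by push_cast; ring]
  exact mul_right_inj' (exp_ne_zero _)

theorem rotate_stdPoint (s : ℝ) (M ξ : ℂ) : rotate s (stdPoint M ξ) = stdPoint (I * s + M) ξ := by
  have h2 := norm_exp_mul_I_mul 2 s
  have h3 := norm_exp_mul_I_mul 3 s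
  push_cast at h2 h3
  have e2 : exp (2 * (I * s + M) + ξ / 3) = exp (2 * (I * s)) * exp (2 * M + ξ / 3) := by
    rw [← exp_add]; ring_nf
  have e3 : exp (3 * (I * s + M)) = exp (3 * (I * s)) * exp (3 * M) := by
    rw [← exp_add]; ring_nf
  have hs : sphereScale (exp (2 * (I * s + M) + ξ / 3), exp (3 * (I * s + M))) =
      sphereScale (exp (2 * M + ξ / 3), exp (3 * M)) := by
    simp only [sphereScale, e2, e3, norm_mul, h2, h3, one_mul]
  refine Subtype.ext (Prod.ext ?_ ?_)
  · simp only [rotate, stdPoint, toSphere, hs]; rw [e2]; ring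
  · simp only [rotate, stdPoint, toSphere, hs]; rw [e3]; ring

theorem sphereScale_of_mem (x : LinkSphere) : sphereScale x.1 = 1 := by
  rw [sphereScale, x.2]; norm_num

/-- A loop in the complement of the trefoil which is the image of a regular orbit of the circle
action under a homeomorphism has trivial winding. -/
theorem orbit_winding_eq_zero (H : LinkSphere ≃ₜ LinkSphere)
    (hH : ∀ x, H x ∈ knotSet ↔ x ∈ knotSet) (y : LinkSphere) {c u v : ℝ → ℂ}
    (h : CuspLift (fun s => (H (rotate s y)).1.1) (fun s => (H (rotate s y)).1.2) c u v)
    (W : ℝ → ℂ) (hW : Continuous W) (hexp : ∀ s, exp (W s) = v s + u s ^ 2 + 3 / 2) :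
    W (12 * (2 * Real.pi)) = W 0 := by
  obtain ⟨U, V, hU, hV, hUV, hU0, hV0, hU1, hV1⟩ := exists_path_neg (u 0) (v 0) (h.eq_v 0)
  let q : ℝ → ℂ × ℂ := fun τ => (c 0 ^ 2 * (1 + U τ ^ 2), c 0 ^ 3 * (U τ * V τ))
  have hqc : Continuous q := by simp only [q]; fun_prop
  have hq3 : ∀ τ, (q τ).1 ^ 3 ≠ (q τ).2 ^ 2 := fun τ he => by
    refine pow_ne_zero 6 (h.c_ne 0) ?_
    simp only [q] at he
    linear_combination he + c 0 ^ 6 * U τ ^ 2 * hUV τ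
  have hq : ∀ τ, q τ ≠ 0 := fun τ h0 => hq3 τ (by rw [h0]; simp)
  have hq0 : q 0 = (H y).1 := by
    have e1 := h.eq_A 0
    have e2 := h.eq_B 0
    simp only [rotate_zero] at e1 e2
    exact Prod.ext (by simp only [q, hU0, e1]) (by simp only [q, hU0, hV0, e2])
  have hq1 : q 1 = q 0 := by
    simp only [q, hU0, hV0, hU1, hV1]
    ring_nf
  have hg0 : toSphere (q 0) (hq 0) = H y := by
    rw [toSphere_congr hq0, toSphere_of_mem]
  have hg1 : toSphere (q 1) (hq 1) = toSphere (q 0) (hq 0) := toSphere_congr hq1 _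
  let G : ℝ × ℝ → LinkSphere := fun x => H (rotate x.1 (H.symm (toSphere (q x.2) (hq x.2))))
  have hGc : Continuous G := by
    refine H.continuous.comp (continuous_rotate.comp (continuous_fst.prodMk ?_))
    exact H.symm.continuous.comp ((hqc.toSphere hq).comp continuous_snd)
  have hG : ∀ x, G x ∉ knotSet := fun x => by
    rw [hH, rotate_mem_knotSet, ← hH, H.apply_symm_apply, toSphere_mem_knotSet]
    exact hq3 _
  have hGp : ∀ s τ, G (s + 2 * Real.pi, τ) = G (s, τ) := fun s τ => by
    simp only [G, rotate_periodic]
  have hG1 : ∀ s, G (s, 1) = G (s, 0) := fun s => by simp only [G, hg1]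
  have hGl : ∀ τ, G (0, τ) = toSphere (q τ) (hq τ) := fun τ => by
    simp only [G, rotate_zero, H.apply_symm_apply]
  have hGb : ∀ s, G (s, 0) = H (rotate s y) := fun s => by
    simp only [G, hg0, H.symm_apply_apply]
  have hs0 : sphereScale (q 0) = 1 := by rw [hq0, sphereScale_of_mem]
  have hsc : Continuous fun τ => (sphereScale (q τ) : ℂ) := by
    simp only [sphereScale]
    refine continuous_ofReal.comp (Continuous.rpow_const
      (continuous_const.div (by fun_prop) fun x => ?_) (by norm_num))
    exact (weight_pos (hq x)).ne'
  refine CuspLift.winding_eq_zero (A := fun x => (G x).1.1) (B := fun x => (G x).1.2)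
    (cg := fun τ => sphereScale (q τ) * c 0) (ug := U) (vg := V) (u := u) (v := v) (c := c)
    (by fun_prop) (by fun_prop) hG (2 * Real.pi) (fun s τ => by rw [hGp]) (fun s τ => by rw [hGp])
    (fun s => by rw [hG1]) (fun s => by rw [hG1]) ?_ ?_ ?_ ?_ ?_ ?_ ?_ ?_ W hW hexp
  · refine ⟨by fun_prop, hU, hV, fun τ => mul_ne_zero ?_ (h.c_ne 0), fun τ => ?_, fun τ => ?_, hUV⟩
    · exact_mod_cast (sphereScale_pos (hq τ)).ne'
    · rw [hGl]
      simp only [toSphere, q]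
      ring
    · rw [hGl]
      simp only [toSphere, q]
      ring
  · rw [hq1]
  · rw [hU0, hU1]
  · rw [hV0, hV1]
  · simpa only [hGb] using h
  · simp only [hs0, ofReal_one, one_mul]
  · exact hU0.symm
  · exact hV0.symm

theorem meridional_degree_eq_zero (H : LinkSphere ≃ₜ LinkSphere)
    (hH : ∀ x, H x ∈ knotSet ↔ x ∈ knotSet) {ρ : ℝ} {δ n : ℤ} {M L : ℝ → ℂ} (hM : Continuous M)
    (hL : Continuous L) (hz : ∀ s : ℝ, H (stdPoint (I * s) ρ) = stdPoint (M s) (exp (L s)))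
    (hre : ∀ s, (L s).re < 0) (hMp : ∀ s, M (s + 2 * Real.pi) = M s + δ * (2 * Real.pi * I))
    (hLp : ∀ s, L (s + 2 * Real.pi) = L s + n * (2 * Real.pi * I)) : n = 0 := by
  have ha : Real.log (1 / 1000) < 0 := Real.log_neg (by norm_num) (by norm_num)
  let β : ℝ × ℝ → LinkSphere := fun x =>
    stdPoint (blend M 0 δ x) (exp (blend L (Real.log (1 / 1000)) n x))
  have hβc : Continuous β := (continuous_blend hM).stdPoint (by
    have := continuous_blend (a := Real.log (1 / 1000)) (k := n) hL
    fun_prop)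
  have hβ : ∀ x, β x ∉ knotSet := fun x => by
    rw [stdPoint_mem_knotSet]
    exact exp_exp_ne_one (blend_re_neg hre ha x)
  have hβp : ∀ s τ, β (s + 2 * Real.pi, τ) = β (s, τ) := fun s τ =>
    stdPoint_congr (exp_blend_periodic hMp s τ) (exp_blend_periodic hLp s τ)
  obtain ⟨c0, u0, v0, hc0, hA0, hB0, hv0⟩ := exists_cuspLift_point _ _ (hβ (0, 0))
  obtain ⟨c, u, v, h, -, -, -⟩ := exists_cuspLift (fun x => (β x).1.1) (fun x => (β x).1.2)
    (by fun_prop) (by fun_prop) hβ c0 u0 v0 hc0 hA0 hB0 hv0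
  obtain ⟨W, m, hW, hexp, hm⟩ := h.exists_winding (2 * Real.pi) (fun s τ => by rw [hβp])
    (fun s τ => by rw [hβp])
  have hβb : ∀ s, β (s, 0) = H (rotate s (stdPoint 0 ρ)) := fun s => by
    rw [rotate_stdPoint, add_zero, hz]
    simp only [β, blend_zero]
  have hm0 : (m : ℂ) * (2 * Real.pi * I) = 0 := by
    have h1 := orbit_winding_eq_zero H hH (stdPoint 0 ρ) (c := fun s => c (s, 0))
      (u := fun s => u (s, 0)) (v := fun s => v (s, 0)) (by
        have := h.comp (fun s : ℝ => (s, (0 : ℝ))) (by fun_prop)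
        simpa only [Function.comp_def, hβb] using this) (fun s => W (s, 0)) (by fun_prop)
      (fun s => hexp (s, 0))
    have h2 := hm 0 0
    rw [zero_add, h1] at h2
    linear_combination -h2
  have hξ : ∀ s : ℝ, exp (blend L (Real.log (1 / 1000)) n (s, 1)) = 1 / 1000 * exp (n * s * I) :=
    fun s => by
      rw [blend_one, exp_add, ← ofReal_exp, Real.exp_log (by norm_num)]
      push_cast
      ring_nf
  refine meridional_winding_eq_zero (g := fun s => v (s, 1) + u (s, 1) ^ 2 + 3 / 2)
    (p := fun s => 1 + u (s, 1) ^ 2) (ξ := fun s => exp (blend L (Real.log (1 / 1000)) n (s, 1)))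
    (ℓ := fun s => W (s, 1)) (T := 12 * (2 * Real.pi)) (by positivity) ?_ (by fun_prop) hξ
    (fun s => ?_) (fun s => ?_) (fun s => hexp (s, 1)) ?_ ?_
  · have := h.continuous_u
    have := h.continuous_v
    fun_prop
  · obtain ⟨ξ, hξ'⟩ : ∃ ξ, ξ = exp (blend L (Real.log (1 / 1000)) n (s, 1)) := ⟨_, rfl⟩
    have hB : (β (s, 1)).1.2 ≠ 0 := by
      refine mul_ne_zero (pow_ne_zero 3 ?_) (exp_ne_zero _)
      exact_mod_cast (sphereScale_pos (exp_pair_ne_zero _ _)).ne'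
    have hAB : (β (s, 1)).1.1 ^ 3 = exp ξ * (β (s, 1)).1.2 ^ 2 := by
      have e1 : ∀ M : ℂ, exp (2 * M + ξ / 3) ^ 3 = exp ξ * exp (3 * M) ^ 2 := fun M => by
        rw [← exp_nat_mul, ← exp_nat_mul, ← exp_add]
        congr 1
        push_cast
        ring
      simp only [β, stdPoint, toSphere, ← hξ', mul_pow, e1]
      ring
    have h6 := h.pow_six (s, 1)
    have hA := h.eq_A (s, 1)
    rw [← hξ']
    refine mul_right_cancel₀ (pow_ne_zero 2 hB) ?_
    rw [hAB] at h6
    rw [hA] at hAB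
    linear_combination hAB - (1 + u (s, 1) ^ 2) ^ 3 * h6
  · have := h.eq_v (s, 1)
    linear_combination this
  · have := hm 0 1
    rw [hm0, zero_add, add_zero] at this
    exact this
  · rw [hξ, hξ, show (n * (12 * (2 * Real.pi) : ℝ) * I : ℂ) = I * (2 * Real.pi * (12 * n : ℤ)) by
      push_cast; ring, exp_two_pi_int]
    simp

theorem chart_stdPoint_unit (σ : ℝ) : chart (stdPoint (I * σ) 0).1 = trefoil (σ + Real.pi) := by
  have e1 : exp (I * σ) = Real.cos σ + Real.sin σ * I := by
    rw [mul_comm, exp_mul_I, ofReal_cos, ofReal_sin]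
  have e2 : exp (-(2 * (I * σ))) = Real.cos (2 * σ) - Real.sin (2 * σ) * I := by
    rw [show -(2 * (I * σ)) = ((-(2 * σ) : ℝ) : ℂ) * I by push_cast; ring, exp_mul_I, ← ofReal_cos,
      ← ofReal_sin, Real.cos_neg, Real.sin_neg]
    push_cast
    ring
  have e3 : exp (3 * (I * σ)) = Real.cos (3 * σ) + Real.sin (3 * σ) * I := by
    rw [show 3 * (I * σ) = ((3 * σ : ℝ) : ℂ) * I by push_cast; ring, exp_mul_I, ofReal_cos,
      ofReal_sin]
  have a2 : 2 * (σ + Real.pi) = 2 * σ + 2 * Real.pi := by ring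
  have a3 : 3 * (σ + Real.pi) = 3 * σ + Real.pi + 2 * Real.pi := by ring
  rw [chart, chartRatio_stdPoint_unit, chartPlane_stdPoint_unit, e1, e2, e3, trefoil, a2, a3]
  rw [Real.sin_add_pi, Real.cos_add_pi, Real.sin_add_two_pi, Real.cos_add_two_pi,
    Real.sin_add_two_pi, Real.sin_add_pi]
  ext i
  fin_cases i
  · simp [-ofReal_cos, -ofReal_sin]
  · simp [-ofReal_cos, -ofReal_sin]
  · simp [-ofReal_cos, -ofReal_sin]

theorem chart_mem_range_trefoil {x : LinkSphere} (hx : x ≠ LinkSphere.pole) :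
    chart x.1 ∈ Set.range trefoil ↔ x ∈ knotSet := by
  have hmem : ∀ σ : ℝ, stdPoint (I * σ) 0 ∈ knotSet := fun σ => stdPoint_mem_knotSet.2 exp_zero
  constructor
  · rintro ⟨t, ht⟩
    have h := chart_stdPoint_unit (t - Real.pi)
    rw [sub_add_cancel, ht] at h
    rw [← chart_injective (stdPoint_ne_pole _ _) hx h]
    exact hmem _
  · intro h
    have h1 : x.1.1 ^ 3 = x.1.2 ^ 2 := h
    have h2 := congrArg norm h1
    rw [norm_pow, norm_pow] at h2
    have h3 : ‖x.1.1‖ ^ 3 = 1 := by linarith [x.2]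
    have h4 : ‖x.1.2‖ ^ 2 = 1 := by linarith
    have h5 : ‖tubeUnit x‖ = 1 := by
      rw [tubeUnit, tubeLog_eq_zero h, zero_div, exp_zero, mul_one, norm_div,
        (pow_eq_one_iff_of_nonneg (norm_nonneg _) three_ne_zero).1 h3,
        (pow_eq_one_iff_of_nonneg (norm_nonneg _) two_ne_zero).1 h4, div_one]
    have h6 : exp (I * arg (tubeUnit x)) = tubeUnit x := by
      have := norm_mul_exp_arg_mul_I (tubeUnit x)
      rw [h5, ofReal_one, one_mul] at this
      rw [mul_comm, this]
    have h7 := eq_stdPoint (knotSet_subset_knotTube h) h6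
    rw [tubeLog_eq_zero h] at h7
    rw [h7, chart_stdPoint_unit]
    exact ⟨_, rfl⟩

theorem mirror_mirror (p : Fin 3 → ℝ) : mirror (mirror p) = p := by
  ext i
  fin_cases i <;> simp [mirror]

/-- The reflection as a homeomorphism. -/
def mirrorHomeo : (Fin 3 → ℝ) ≃ₜ (Fin 3 → ℝ) where
  toFun := mirror
  invFun := mirror
  left_inv := mirror_mirror
  right_inv := mirror_mirror
  continuous_toFun := by unfold mirror; fun_prop
  continuous_invFun := by unfold mirror; fun_prop

theorem sphereLift_mem_knotSet {h : (Fin 3 → ℝ) ≃ₜ (Fin 3 → ℝ)}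
    (hh : ∀ p, h p ∈ Set.range trefoil ↔ p ∈ Set.range trefoil) (x : LinkSphere) :
    sphereLift h x ∈ knotSet ↔ x ∈ knotSet := by
  by_cases hx : x = LinkSphere.pole
  · rw [hx, sphereLift_pole]
  · rw [← chart_mem_range_trefoil hx, ← chart_mem_range_trefoil (sphereLift_ne_pole h hx),
      chart_sphereLift h hx, hh]

/-- A homeomorphism preserving the trefoil preserves the sign of the linking number of the
trefoil with its transverse pushoff. -/
theorem exists_linkingDegree_sphereLift (H : LinkSphere ≃ₜ LinkSphere)
    (hH : ∀ x, H x ∈ knotSet ↔ x ∈ knotSet) : ∃ (ρ : ℝ) (δ : ℤ), 0 < ρ ∧ ∀ n : ℤ,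
      LinkingDegree (fun s => chart (H (stdPoint (I * s) ρ)).1)
        (fun s => chart (H (stdPoint (I * s) 0)).1) n → n = 6 * δ ^ 2 := by
  obtain ⟨ρ, δ, n, M, M', L, hρ, hM, hM', hL, hz, hk, hre, hMp, hMp', hLp⟩ :=
    exists_peripheral_logs H hH
  obtain rfl := meridional_degree_eq_zero H hH hM hL hz hre hMp hLp
  refine ⟨ρ, δ, hρ, fun n hn => ?_⟩
  have ha : Real.log (1 / 1000) < 0 := Real.log_neg (by norm_num) (by norm_num)
  have hMc := continuous_blend (a := 0) (k := δ) hM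
  have hMc' := continuous_blend (a := 0) (k := δ) hM'
  have hLc := continuous_blend (a := Real.log (1 / 1000)) (k := 0) hL
  have key := LinkingDegree.homotopy (z := fun x => chart (stdPoint (blend M 0 δ (x.2, x.1))
      (exp (blend L (Real.log (1 / 1000)) 0 (x.2, x.1)))).1)
    (k := fun x => chart (stdPoint (blend M' 0 δ (x.2, x.1)) 0).1) (n := n) (τ₀ := 0)
    (continuous_chart_comp (Continuous.stdPoint (by fun_prop) (by fun_prop))
      fun x => stdPoint_ne_pole _ _)
    (continuous_chart_comp (Continuous.stdPoint (by fun_prop) (by fun_prop))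
      fun x => stdPoint_ne_pole _ _)
    (fun τ s => by
      rw [stdPoint_congr (exp_blend_periodic hMp s τ) (exp_blend_periodic hLp s τ)])
    (fun τ s => by rw [stdPoint_congr (exp_blend_periodic hMp' s τ) rfl])
    (fun τ s σ h => ?_) 1 ?_
  · have hstd := linkingDegree_stdPoint δ (ρ := 1 / 1000) (by norm_num)
    simp only [blend_one, exp_add, ← ofReal_exp] at key
    rw [Real.exp_log (by norm_num)] at key
    simp only [ofReal_zero, zero_add, Int.cast_zero, zero_mul, mul_zero, exp_zero, mul_one] at key
    exact key.unique hstd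
  · have h1 := chart_injective (stdPoint_ne_pole _ _) (stdPoint_ne_pole _ _) h
    have h2 : stdPoint (blend M' 0 δ (σ, τ)) 0 ∈ knotSet := stdPoint_mem_knotSet.2 exp_zero
    rw [← h1, stdPoint_mem_knotSet] at h2
    exact exp_exp_ne_one (blend_re_neg hre ha _) h2
  · simpa only [blend_zero, ← hz, ← hk] using hn

/-- Dehn (1914): the right-handed trefoil knot is not ambient isotopic to its mirror
image, the left-handed trefoil knot; that is, the trefoil is not amphicheiral. -/
theorem trefoil_not_amphicheiral :
    ¬ AmbientIsotopic (Set.range trefoil) (mirror '' Set.range trefoil) := by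
  rintro ⟨F, hFc, hF, hF0, hF1⟩
  let h : (Fin 3 → ℝ) ≃ₜ (Fin 3 → ℝ) := (hF 1).homeomorph.trans mirrorHomeo
  have hh : ∀ p, h p = mirror (F 1 p) := fun p => rfl
  have hpres : ∀ p, h p ∈ Set.range trefoil ↔ p ∈ Set.range trefoil := fun p => by
    rw [hh, ← (hF 1).injective.mem_set_image (s := Set.range trefoil) (a := p), hF1]
    exact ⟨fun hp => ⟨_, hp, mirror_mirror _⟩, fun ⟨y, hy, he⟩ => by
      rw [← he, mirror_mirror]; exact hy⟩
  obtain ⟨ρ, δ, hρ, hdeg⟩ :=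
    exists_linkingDegree_sphereLift (sphereLift h) (sphereLift_mem_knotSet hpres)
  have hper : ∀ (s : ℝ) (ξ : ℂ), stdPoint (I * (s + 2 * Real.pi : ℝ)) ξ = stdPoint (I * s) ξ :=
    fun s ξ => stdPoint_congr (exp_I_periodic s) rfl
  have hcont : ∀ ξ : ℂ, Continuous fun x : ℝ × ℝ => F x.1 (chart (stdPoint (I * x.2) ξ).1) :=
    fun ξ => hFc.comp (continuous_fst.prodMk (continuous_chart_comp
      (Continuous.stdPoint (by fun_prop) (by fun_prop)) fun x => stdPoint_ne_pole _ _))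
  have hlink := LinkingDegree.homotopy (n := 6) (τ₀ := 0) (hcont ρ) (hcont 0)
    (fun τ s => by rw [hper]) (fun τ s => by rw [hper]) (fun τ s σ he => ?_) 1 ?_
  · have hneg := hdeg (-6) (by
      convert hlink.reflect using 1
      · ext1 s; rw [chart_sphereLift h (stdPoint_ne_pole _ _), hh]
      · ext1 s; rw [chart_sphereLift h (stdPoint_ne_pole _ _), hh])
    nlinarith [sq_nonneg δ]
  · have h1 := chart_injective (stdPoint_ne_pole _ _) (stdPoint_ne_pole _ _) ((hF τ).injective he)
    have h2 : stdPoint (I * σ) 0 ∈ knotSet := stdPoint_mem_knotSet.2 exp_zero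
    rw [← h1, stdPoint_mem_knotSet, ← ofReal_exp] at h2
    norm_cast at h2
    rw [Real.exp_eq_one_iff] at h2
    exact hρ.ne' h2
  · have := linkingDegree_stdPoint 1 hρ
    simpa [hF0] using this
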